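/- arXiv:2404.01962 — 6 statements merged into one kernel-verified Lean document; each statement's English description precedes it below -/
import Mathlib

section
/- Let A = diag(s_1,…,s_n) with s_1 ≥ … ≥ s_n > 0 and let α ≥ n. Then there exist constants c, C > 0 depending only on n and α such that c/(s_1⋯s_n · s_n^{α-n}) ≤ ∫_{S^{n-1}} |Ax|^{-α} dx ≤ C/(s_1⋯s_n · s_n^{α-n}). -/
open MeasureTheory Metric Finset

theorem lintegral_eq_lintegral_toSphere_lintegral_Ioi {E : Type*} [NormedAddCommGroup E]
    [NormedSpace ℝ E] [Nontrivial E] [FiniteDimensional ℝ E] [MeasurableSpace E] [BorelSpace E]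
    (μ : Measure E) [μ.IsAddHaarMeasure] {f : E → ENNReal} (hf : Measurable f) :
    ∫⁻ x, f x ∂μ = ∫⁻ u : sphere (0 : E) 1, (∫⁻ r in Set.Ioi (0 : ℝ),
      ENNReal.ofReal (r ^ (Module.finrank ℝ E - 1)) * f (r • (u : E))) ∂μ.toSphere := by
  calc
    ∫⁻ x, f x ∂μ = ∫⁻ x : ({(0)}ᶜ : Set E), f x ∂(μ.comap (↑)) := by
      rw [lintegral_subtype_comap (measurableSet_singleton _).compl f, restrict_compl_singleton]
    _ = ∫⁻ y : sphere (0 : E) 1 × Set.Ioi (0 : ℝ), f (y.2.1 • y.1.1)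
          ∂μ.toSphere.prod (.volumeIoiPow (Module.finrank ℝ E - 1)) := by
      rw [← μ.measurePreserving_homeomorphUnitSphereProd.lintegral_comp_emb
        (Homeomorph.measurableEmbedding _)]
      refine lintegral_congr fun x => ?_
      have hx : ‖(x : E)‖ ≠ 0 := norm_ne_zero_iff.2 x.2
      simp [smul_smul, hx]
    _ = _ := by
      rw [lintegral_prod _ (by fun_prop)]
      refine lintegral_congr fun u => ?_
      rw [Measure.volumeIoiPow, lintegral_withDensity_eq_lintegral_mul _ (by fun_prop)
        (by fun_prop), ← lintegral_subtype_comap measurableSet_Ioi]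
      rfl

theorem lintegral_Ioo_rpow_sub_one {α R : ℝ} (hα : 0 < α) (hR : 0 < R) :
    ∫⁻ r in Set.Ioo 0 R, ENNReal.ofReal (r ^ (α - 1)) = ENNReal.ofReal (R ^ α / α) := by
  have hint : IntervalIntegrable (fun r : ℝ => r ^ (α - 1)) volume 0 R :=
    intervalIntegral.intervalIntegrable_rpow' (by linarith)
  rw [Measure.restrict_congr_set Ioo_ae_eq_Ioc, ← ofReal_integral_eq_lintegral_ofReal
    ((intervalIntegrable_iff_integrableOn_Ioc_of_le hR.le).1 hint),
    ← intervalIntegral.integral_of_le hR.le, integral_rpow (Or.inl (by linarith))]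
  · simp [hα.ne', Real.zero_rpow]
  · filter_upwards [ae_restrict_mem measurableSet_Ioc] with r hr
    exact Real.rpow_nonneg hr.1.le _

theorem lintegral_toSphere_norm_rpow_neg {E : Type*} [NormedAddCommGroup E]
    [NormedSpace ℝ E] [Nontrivial E] [FiniteDimensional ℝ E] [MeasurableSpace E] [BorelSpace E]
    (μ : Measure E) [μ.IsAddHaarMeasure] {L : E →ₗ[ℝ] E} (hL : Function.Injective L)
    {α : ℝ} (hα : 0 < α) :
    ∫⁻ u : sphere (0 : E) 1, ENNReal.ofReal (‖L u‖ ^ (-α)) ∂μ.toSphere =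
      ENNReal.ofReal α *
        ∫⁻ x in L ⁻¹' ball 0 1, ENNReal.ofReal (‖x‖ ^ (α - Module.finrank ℝ E)) ∂μ := by
  have hLc : Continuous L := L.continuous_of_finiteDimensional
  have hS : MeasurableSet (L ⁻¹' ball 0 1) := (isOpen_ball.preimage hLc).measurableSet
  have hd : 0 < Module.finrank ℝ E := Module.finrank_pos
  rw [← lintegral_indicator hS, lintegral_eq_lintegral_toSphere_lintegral_Ioi μ
    (Measurable.indicator (by fun_prop) hS), ← lintegral_const_mul' _ _ ENNReal.ofReal_ne_top]
  refine lintegral_congr fun u => ?_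
  have hu : ‖(u : E)‖ = 1 := by simp
  have hLu : 0 < ‖L u‖ := by
    rw [norm_pos_iff, Ne, map_eq_zero_iff L hL]
    exact norm_ne_zero_iff.1 (by simp [hu])
  have hinner : ∫⁻ r in Set.Ioi (0 : ℝ), ENNReal.ofReal (r ^ (Module.finrank ℝ E - 1)) *
      (L ⁻¹' ball 0 1).indicator
        (fun x => ENNReal.ofReal (‖x‖ ^ (α - Module.finrank ℝ E))) (r • (u : E)) =
      ∫⁻ r in Set.Ioo 0 ‖L u‖⁻¹, ENNReal.ofReal (r ^ (α - 1)) := by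
    rw [← lintegral_indicator measurableSet_Ioi, ← lintegral_indicator measurableSet_Ioo]
    refine lintegral_congr fun r => ?_
    by_cases hr : 0 < r
    · have hmem : r • (u : E) ∈ L ⁻¹' ball 0 1 ↔ r < ‖L u‖⁻¹ := by
        rw [Set.mem_preimage, mem_ball_zero_iff, map_smul, norm_smul, Real.norm_of_nonneg hr.le,
          lt_inv_comm₀ hr hLu, ← lt_div_iff₀' hr, one_div]
      by_cases hr' : r < ‖L u‖⁻¹
      · rw [Set.indicator_of_mem (Set.mem_Ioi.2 hr), Set.indicator_of_mem (hmem.2 hr'),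
          Set.indicator_of_mem (Set.mem_Ioo.2 ⟨hr, hr'⟩), ← ENNReal.ofReal_mul (by positivity),
          norm_smul, hu, mul_one, Real.norm_of_nonneg hr.le, ← Real.rpow_natCast,
          ← Real.rpow_add hr, Nat.cast_pred hd]
        ring_nf
      · rw [Set.indicator_of_mem (Set.mem_Ioi.2 hr),
          Set.indicator_of_notMem (fun h => hr' (hmem.1 h)),
          Set.indicator_of_notMem (fun h => hr' h.2), mul_zero]
    · rw [Set.indicator_of_notMem (Set.notMem_Ioi.2 (not_lt.1 hr)),
        Set.indicator_of_notMem (fun h => hr h.1)]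
  rw [hinner, lintegral_Ioo_rpow_sub_one hα (inv_pos.2 hLu), ← ENNReal.ofReal_mul hα.le,
    Real.inv_rpow hLu.le, Real.rpow_neg hLu.le]
  congr 1
  field_simp

theorem det_toLpLin_diagonal {n : ℕ} (s : Fin n → ℝ) :
    LinearMap.det (Matrix.toLpLin 2 2 (Matrix.diagonal s)) = ∏ i, s i := by
  rw [Matrix.toLpLin_eq_toLin, LinearMap.det_toLin, Matrix.det_diagonal]

theorem toLpLin_diagonal_apply {n : ℕ} (s : Fin n → ℝ) (x : EuclideanSpace ℝ (Fin n))
    (i : Fin n) : Matrix.toLpLin 2 2 (Matrix.diagonal s) x i = s i * x i := by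
  simp [Matrix.toLpLin_apply, Matrix.mulVec_diagonal]

theorem mul_norm_le_norm_toLpLin_diagonal {n : ℕ} {s : Fin n → ℝ} {m : ℝ} (hm : 0 ≤ m)
    (hs : ∀ i, m ≤ s i) (x : EuclideanSpace ℝ (Fin n)) :
    m * ‖x‖ ≤ ‖Matrix.toLpLin 2 2 (Matrix.diagonal s) x‖ := by
  refine le_of_sq_le_sq ?_ (norm_nonneg _)
  rw [mul_pow, EuclideanSpace.norm_sq_eq, EuclideanSpace.norm_sq_eq, mul_sum]
  refine sum_le_sum fun i _ => ?_
  rw [toLpLin_diagonal_apply, norm_mul, mul_pow, Real.norm_of_nonneg (hm.trans (hs i))]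
  gcongr
  exact hs i

/-- Case `α ≥ n` of the key integral estimate: for `A = diag(s₁,…,sₙ)` with
`s₁ ≥ ⋯ ≥ sₙ > 0` and `α ≥ n`, `∫_{S^{n-1}} |Ax|^{-α} dx ≈ 1/(s₁⋯sₙ · sₙ^{α-n})`,
with constants depending only on `n` and `α`. -/
theorem integral_estimate_ge_dim (n : ℕ) (hn : 0 < n) (α : ℝ) (hα : (n : ℝ) ≤ α) :
    ∃ c C : ℝ, 0 < c ∧ 0 < C ∧
      ∀ s : Fin n → ℝ, (∀ i, 0 < s i) → (∀ i j : Fin n, i ≤ j → s j ≤ s i) →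
        c / ((∏ i, s i) * s ⟨n - 1, by omega⟩ ^ (α - n)) ≤
          (∫ x : sphere (0 : EuclideanSpace ℝ (Fin n)) 1,
            ‖(EuclideanSpace.equiv (Fin n) ℝ).symm
              ((Matrix.diagonal s).mulVec (x : EuclideanSpace ℝ (Fin n)))‖ ^ (-α)
            ∂(volume : Measure (EuclideanSpace ℝ (Fin n))).toSphere) ∧
        (∫ x : sphere (0 : EuclideanSpace ℝ (Fin n)) 1,
            ‖(EuclideanSpace.equiv (Fin n) ℝ).symm
              ((Matrix.diagonal s).mulVec (x : EuclideanSpace ℝ (Fin n)))‖ ^ (-α)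
            ∂(volume : Measure (EuclideanSpace ℝ (Fin n))).toSphere) ≤
          C / ((∏ i, s i) * s ⟨n - 1, by omega⟩ ^ (α - n)) := by
  have : NeZero n := ⟨hn.ne'⟩
  have hα₀ : 0 < α := (Nat.cast_pos.2 hn).trans_le hα
  set k : Fin n := ⟨n - 1, by omega⟩ with hk
  set B : Set (EuclideanSpace ℝ (Fin n)) := ball 0 1
  set U : Set (EuclideanSpace ℝ (Fin n)) := B ∩ {y | 1 / 2 < y k}
  have hUo : IsOpen U := isOpen_ball.inter (isOpen_lt continuous_const (by fun_prop))
  have hB_top : volume B ≠ ⊤ := measure_ball_lt_top.ne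
  have hU_top : volume U ≠ ⊤ := measure_ne_top_of_subset Set.inter_subset_left hB_top
  have hU_pos : 0 < volume.real U := by
    refine ENNReal.toReal_pos (hUo.measure_pos _ ⟨EuclideanSpace.single k (3 / 4), ?_, ?_⟩).ne'
      hU_top
    · rw [mem_ball_zero_iff, PiLp.norm_single]
      norm_num
    · simp only [Set.mem_ofPred_eq, PiLp.single_apply, if_true]
      norm_num
  have hB_pos : 0 < volume.real B :=
    hU_pos.trans_le (measureReal_mono Set.inter_subset_left hB_top)
  refine ⟨α * (1 / 2) ^ (α - n) * volume.real U, α * volume.real B, by positivity, by positivity,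
    fun s hs hanti => ?_⟩
  set L := Matrix.toLpLin 2 2 (Matrix.diagonal s) with hLdef
  have hm : ∀ i, s k ≤ s i := fun i => hanti i k (Fin.le_def.2 (by simp only [hk]; omega))
  have hsk : 0 < s k := hs k
  have hp : 0 ≤ α - n := sub_nonneg.2 hα
  have hnorm : ∀ x, s k * ‖x‖ ≤ ‖L x‖ :=
    mul_norm_le_norm_toLpLin_diagonal hsk.le hm
  have hdet : LinearMap.det L = ∏ i, s i := det_toLpLin_diagonal s
  have hprod : 0 < ∏ i, s i := prod_pos fun i _ => hs i
  have hdet₀ : LinearMap.det L ≠ 0 := hdet ▸ hprod.ne'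
  have hL : Function.Injective L := (LinearMap.equivOfDetNeZero L hdet₀).injective
  have hLc : Continuous L := L.continuous_of_finiteDimensional
  have hpre : ∀ S, volume (L ⁻¹' S) = ENNReal.ofReal (∏ i, s i)⁻¹ * volume S := fun S => by
    rw [Measure.addHaar_preimage_linearMap volume hdet₀, hdet, abs_of_pos (inv_pos.2 hprod)]
  set J := ∫⁻ x in L ⁻¹' B, ENNReal.ofReal (‖x‖ ^ (α - n))
  have hI : (∫ x : sphere (0 : EuclideanSpace ℝ (Fin n)) 1,
      ‖(EuclideanSpace.equiv (Fin n) ℝ).symm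
        ((Matrix.diagonal s).mulVec (x : EuclideanSpace ℝ (Fin n)))‖ ^ (-α)
      ∂(volume : Measure (EuclideanSpace ℝ (Fin n))).toSphere) = α * J.toReal := by
    change (∫ x : sphere (0 : EuclideanSpace ℝ (Fin n)) 1, ‖L x‖ ^ (-α)
      ∂(volume : Measure (EuclideanSpace ℝ (Fin n))).toSphere) = _
    rw [integral_eq_lintegral_of_nonneg_ae (.of_forall fun x => by positivity)
      (Measurable.aestronglyMeasurable (by fun_prop)),
      lintegral_toSphere_norm_rpow_neg volume hL hα₀, ENNReal.toReal_mul,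
      ENNReal.toReal_ofReal hα₀.le, finrank_euclideanSpace_fin]
  have hJ_le : J ≤ ENNReal.ofReal ((s k)⁻¹ ^ (α - n)) * volume (L ⁻¹' B) := by
    rw [← setLIntegral_const]
    refine setLIntegral_mono measurable_const fun x hx => ENNReal.ofReal_le_ofReal ?_
    refine Real.rpow_le_rpow (norm_nonneg _) ?_ hp
    rw [← one_div, le_div_iff₀' hsk]
    exact (hnorm x).trans (mem_ball_zero_iff.1 hx).le
  have hJ_ge : ENNReal.ofReal ((1 / 2 / s k) ^ (α - n)) * volume (L ⁻¹' U) ≤ J := by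
    rw [← setLIntegral_const]
    refine (setLIntegral_mono' (hUo.preimage hLc).measurableSet fun x hx =>
      ENNReal.ofReal_le_ofReal ?_).trans
      (lintegral_mono_set (Set.preimage_mono Set.inter_subset_left))
    refine Real.rpow_le_rpow (by positivity) ?_ hp
    have hxk : 1 / 2 < L x k := hx.2
    rw [toLpLin_diagonal_apply] at hxk
    rw [div_le_iff₀' hsk]
    exact hxk.le.trans (mul_le_mul_of_nonneg_left
      ((le_abs_self _).trans (PiLp.norm_apply_le x k)) hsk.le)
  rw [hpre] at hJ_le hJ_ge
  have hub_top : ENNReal.ofReal ((s k)⁻¹ ^ (α - n)) *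
      (ENNReal.ofReal (∏ i, s i)⁻¹ * volume B) ≠ ⊤ := by finiteness
  have hub := ENNReal.toReal_mono hub_top hJ_le
  have hlb := ENNReal.toReal_mono (ne_top_of_le_ne_top hub_top hJ_le) hJ_ge
  simp only [ENNReal.toReal_mul, ← measureReal_def] at hub hlb
  rw [ENNReal.toReal_ofReal (by positivity), ENNReal.toReal_ofReal (by positivity)] at hub hlb
  rw [Real.inv_rpow hsk.le] at hub
  rw [Real.div_rpow (by norm_num) hsk.le] at hlb
  rw [hI]
  constructor
  · refine le_trans (le_of_eq ?_) (mul_le_mul_of_nonneg_left hlb hα₀.le)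
    field_simp
  · refine (mul_le_mul_of_nonneg_left hub hα₀.le).trans (le_of_eq ?_)
    field_simp
end

section
/- Let A = diag(s_1,…,s_n) with s_1 ≥ … ≥ s_n > 0, and let α ∈ (0,n) be a non-integer. Write ⌈α⌉ for the ceiling of α. Then there exist constants c, C > 0 depending only on n and α such that c/(s_1⋯s_{⌈α⌉} · s_{⌈α⌉}^{α-⌈α⌉}) ≤ ∫_{S^{n-1}} |Ax|^{-α} dx ≤ C/(s_1⋯s_{⌈α⌉} · s_{⌈α⌉}^{α-⌈α⌉}). -/
open MeasureTheory Metric Finset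

theorem lintegral_eq_lintegral_sphere_Ioi {E : Type*} [NormedAddCommGroup E] [NormedSpace ℝ E]
    [MeasurableSpace E] [BorelSpace E] [FiniteDimensional ℝ E] [Nontrivial E]
    (μ : Measure E) [μ.IsAddHaarMeasure] {f : E → ENNReal} (hf : Measurable f) :
    ∫⁻ x, f x ∂μ = ∫⁻ ω : sphere (0 : E) 1, ∫⁻ r in Set.Ioi (0 : ℝ),
      ENNReal.ofReal (r ^ (Module.finrank ℝ E - 1)) * f (r • (ω : E)) ∂volume ∂μ.toSphere := by
  have hF : Measurable fun p : sphere (0 : E) 1 × Set.Ioi (0 : ℝ) => f ((p.2 : ℝ) • (p.1 : E)) :=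
    hf.comp (by fun_prop)
  have hpolar := μ.measurePreserving_homeomorphUnitSphereProd.lintegral_comp hF
  have hcomp : ∀ x : ({0}ᶜ : Set E), f (((homeomorphUnitSphereProd E x).2 : ℝ) •
      ((homeomorphUnitSphereProd E x).1 : E)) = f x := fun x => by
    have hx : ‖(x : E)‖ ≠ 0 := norm_ne_zero_iff.mpr x.2
    simp [smul_smul, hx]
  simp only [hcomp] at hpolar
  rw [lintegral_subtype_comap (measurableSet_singleton _).compl, restrict_compl_singleton,
    lintegral_prod _ hF.aemeasurable] at hpolar
  rw [hpolar]
  refine lintegral_congr fun ω => ?_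
  have hω : Measurable fun r : Set.Ioi (0 : ℝ) => f ((r : ℝ) • (ω : E)) :=
    hf.comp (by fun_prop)
  rw [Measure.volumeIoiPow, lintegral_withDensity_eq_lintegral_mul _ (by fun_prop) hω]
  exact lintegral_subtype_comap measurableSet_Ioi
    fun r : ℝ => ENNReal.ofReal (r ^ (Module.finrank ℝ E - 1)) * f (r • (ω : E))

theorem lintegral_Ioi_rpow_mul_exp_neg_sq {q : ℝ} (hq : -1 < q) :
    ∫⁻ r in Set.Ioi (0 : ℝ), ENNReal.ofReal (r ^ q * Real.exp (-r ^ 2)) =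
      ENNReal.ofReal (1 / 2 * Real.Gamma ((q + 1) / 2)) := by
  have h := integral_rpow_mul_exp_neg_rpow (p := 2) (by norm_num) hq
  simp only [Real.rpow_two] at h
  have hint := integrableOn_rpow_mul_exp_neg_mul_sq one_pos hq
  simp only [neg_mul, one_mul] at hint
  rw [← h, ofReal_integral_eq_lintegral_ofReal hint]
  filter_upwards [ae_restrict_mem measurableSet_Ioi] with r hr
  have : 0 < r := hr
  positivity

theorem lintegral_homogeneous_mul_gaussian {E : Type*} [NormedAddCommGroup E] [NormedSpace ℝ E]
    [MeasurableSpace E] [BorelSpace E] [FiniteDimensional ℝ E] [Nontrivial E]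
    (μ : Measure E) [μ.IsAddHaarMeasure] {g : E → ℝ} (hg : Measurable g) {α : ℝ}
    (hα : α < Module.finrank ℝ E) (hgα : ∀ r : ℝ, 0 < r → ∀ x, g (r • x) = r ^ (-α) * g x) :
    ∫⁻ x, ENNReal.ofReal (g x * Real.exp (-‖x‖ ^ 2)) ∂μ =
      ENNReal.ofReal (1 / 2 * Real.Gamma ((Module.finrank ℝ E - α) / 2)) *
        ∫⁻ ω : sphere (0 : E) 1, ENNReal.ofReal (g ω) ∂μ.toSphere := by
  rw [lintegral_eq_lintegral_sphere_Ioi μ (by fun_prop),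
    ← lintegral_const_mul _ (by fun_prop)]
  refine lintegral_congr fun ω => ?_
  have hq : (-1 : ℝ) < Module.finrank ℝ E - 1 - α := by linarith
  have h := lintegral_Ioi_rpow_mul_exp_neg_sq hq
  rw [show (Module.finrank ℝ E : ℝ) - 1 - α + 1 = Module.finrank ℝ E - α by ring] at h
  rw [← h, ← lintegral_mul_const _ (by fun_prop)]
  refine setLIntegral_congr_fun measurableSet_Ioi fun r hr => ?_
  have hr : 0 < r := hr
  have hω : ‖(ω : E)‖ = 1 := by simp
  have hpow : r ^ ((Module.finrank ℝ E : ℝ) - 1 - α) =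
      r ^ (Module.finrank ℝ E - 1) * r ^ (-α) := by
    rw [← Real.rpow_natCast, ← Real.rpow_add hr, Nat.cast_sub Module.finrank_pos]
    simp [sub_eq_add_neg]
  rw [← ENNReal.ofReal_mul (by positivity), ← ENNReal.ofReal_mul (by positivity)]
  congr 1
  rw [hgα r hr, norm_smul, hω, hpow, Real.norm_of_nonneg hr.le]
  ring_nf

theorem lintegral_Ioi_rpow_mul_exp_neg_mul {a r : ℝ} (ha : 0 < a) (hr : 0 < r) :
    ∫⁻ t in Set.Ioi (0 : ℝ), ENNReal.ofReal (t ^ (a - 1) * Real.exp (-(t * r))) =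
      ENNReal.ofReal (Real.Gamma a * r ^ (-a)) := by
  have h := Real.integral_rpow_mul_exp_neg_mul_Ioi ha hr
  have hG := Real.Gamma_pos_of_pos ha
  have h' : Real.Gamma a * r ^ (-a) = (1 / r) ^ a * Real.Gamma a := by
    rw [Real.rpow_neg hr.le, one_div, Real.inv_rpow hr.le, mul_comm]
  simp only [mul_comm r] at h
  rw [h', ← h, ofReal_integral_eq_lintegral_ofReal]
  · refine Integrable.of_integral_ne_zero ?_
    rw [h]
    positivity
  · filter_upwards [ae_restrict_mem measurableSet_Ioi] with t ht
    have : 0 < t := ht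
    positivity

theorem lintegral_exp_neg_sum_mul_sq {ι : Type*} [Fintype ι] {b : ι → ℝ} (hb : ∀ i, 0 < b i) :
    ∫⁻ x : EuclideanSpace ℝ ι, ENNReal.ofReal (Real.exp (-∑ i, b i * x i ^ 2)) =
      ENNReal.ofReal (∏ i, √(Real.pi / b i)) := by
  have hprod : ∀ x : ι → ℝ, Real.exp (-∑ i, b i * x i ^ 2) = ∏ i, Real.exp (-b i * x i ^ 2) :=
    fun x => by simp [← Real.exp_sum]
  have hint : Integrable fun x : ι → ℝ => ∏ i, Real.exp (-b i * x i ^ 2) :=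
    Integrable.fintype_prod fun i => integrable_exp_neg_mul_sq (hb i)
  rw [← (PiLp.volume_preserving_toLp ι).lintegral_comp (by fun_prop)]
  simp only [hprod]
  rw [← ofReal_integral_eq_lintegral_ofReal hint (.of_forall fun x => by positivity),
    integral_fintype_prod_volume_eq_prod (fun i (y : ℝ) => Real.exp (-b i * y ^ 2))]
  simp only [integral_gaussian]

theorem Gamma_mul_lintegral_sphere_weighted_rpow {n : ℕ} {α : ℝ} (hα0 : 0 < α) (hαn : α < n)
    {s : Fin n → ℝ} (hs : ∀ i, 0 < s i) :
    ENNReal.ofReal (Real.Gamma (α / 2) * (1 / 2 * Real.Gamma ((n - α) / 2))) *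
      ∫⁻ ω : sphere (0 : EuclideanSpace ℝ (Fin n)) 1,
        ENNReal.ofReal ((∑ i, (s i * (ω : EuclideanSpace ℝ (Fin n)) i) ^ 2) ^ (-(α / 2)))
        ∂(volume : Measure (EuclideanSpace ℝ (Fin n))).toSphere =
    ∫⁻ t in Set.Ioi (0 : ℝ),
      ENNReal.ofReal (t ^ (α / 2 - 1) * ∏ i, √(Real.pi / (1 + t * s i ^ 2))) := by
  have hn : 0 < n := by exact_mod_cast hα0.trans hαn
  have : NeZero n := ⟨hn.ne'⟩
  have hG := Real.Gamma_pos_of_pos (half_pos hα0)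
  have hpolar := lintegral_homogeneous_mul_gaussian (α := α)
    (volume : Measure (EuclideanSpace ℝ (Fin n)))
    (g := fun x => (∑ i, (s i * x i) ^ 2) ^ (-(α / 2))) (by fun_prop) (by simpa using hαn)
    fun r hr x => by
      have : ∑ i, (s i * (r • x) i) ^ 2 = r ^ 2 * ∑ i, (s i * x i) ^ 2 := by
        rw [Finset.mul_sum]
        exact Finset.sum_congr rfl fun i _ => by simp; ring
      rw [this, Real.mul_rpow (by positivity) (by positivity), ← Real.rpow_natCast,
        ← Real.rpow_mul hr.le]
      ring_nf
  rw [finrank_euclideanSpace_fin] at hpolar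
  rw [ENNReal.ofReal_mul hG.le, mul_assoc, ← hpolar, ← lintegral_const_mul _ (by fun_prop)]
  calc
    _ = ∫⁻ x : EuclideanSpace ℝ (Fin n), ∫⁻ t in Set.Ioi (0 : ℝ),
        ENNReal.ofReal (t ^ (α / 2 - 1)) *
          ENNReal.ofReal (Real.exp (-∑ i, (1 + t * s i ^ 2) * x i ^ 2)) := by
      have hne : ∀ᵐ x : EuclideanSpace ℝ (Fin n), x ≠ 0 := by
        simp [ae_iff]
      refine lintegral_congr_ae ?_
      filter_upwards [hne] with x hx
      have hQ : 0 < ∑ i, (s i * x i) ^ 2 := by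
        obtain ⟨i, hi⟩ : ∃ i, x i ≠ 0 := by
          by_contra! h
          exact hx (by ext i; simpa using h i)
        exact Finset.sum_pos' (fun i _ => sq_nonneg _)
          ⟨i, Finset.mem_univ i, by have := hs i; positivity⟩
      rw [ENNReal.ofReal_mul (by positivity), ← mul_assoc, ← ENNReal.ofReal_mul hG.le,
        ← lintegral_Ioi_rpow_mul_exp_neg_mul (half_pos hα0) hQ,
        ← lintegral_mul_const _ (by fun_prop)]
      refine setLIntegral_congr_fun measurableSet_Ioi fun t ht => ?_
      have ht : 0 < t := ht
      rw [← ENNReal.ofReal_mul (by positivity), ← ENNReal.ofReal_mul (by positivity), mul_assoc,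
        ← Real.exp_add, EuclideanSpace.real_norm_sq_eq, Finset.mul_sum, ← Finset.sum_neg_distrib,
        ← Finset.sum_neg_distrib, ← Finset.sum_add_distrib, ← Finset.sum_neg_distrib]
      congr 4 with i
      ring
    _ = _ := by
      rw [lintegral_lintegral_swap (by fun_prop)]
      refine setLIntegral_congr_fun measurableSet_Ioi fun t ht => ?_
      have ht : 0 < t := ht
      rw [lintegral_const_mul _ (by fun_prop), lintegral_exp_neg_sum_mul_sq
        fun i => by positivity, ← ENNReal.ofReal_mul (by positivity)]

theorem integrableOn_Ioi_rpow_mul_sqrt {β : ℝ} (hβ : -(1 / 2) < β) (hβ0 : β < 0) :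
    IntegrableOn (fun u : ℝ => u ^ (β - 1) * √(u / (1 + u))) (Set.Ioi 0) := by
  have hm : Measurable fun u : ℝ => u ^ (β - 1) * √(u / (1 + u)) := by fun_prop
  rw [← Set.Ioc_union_Ioi_eq_Ioi zero_le_one, integrableOn_union]
  constructor
  · have h : IntegrableOn (fun u : ℝ => u ^ (β - 1 / 2)) (Set.Ioc 0 1) :=
      (intervalIntegral.intervalIntegrable_rpow' (by linarith)).1
    refine h.mono' hm.aestronglyMeasurable ?_
    filter_upwards [ae_restrict_mem measurableSet_Ioc] with u hu
    have hu0 : 0 < u := hu.1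
    rw [Real.norm_of_nonneg (by positivity), show β - 1 / 2 = β - 1 + 1 / 2 by ring,
      Real.rpow_add hu0, ← Real.sqrt_eq_rpow]
    gcongr
    exact div_le_self hu0.le (by linarith)
  · refine (integrableOn_Ioi_rpow_of_lt (a := β - 1) (by linarith) one_pos).mono'
      hm.aestronglyMeasurable ?_
    filter_upwards [ae_restrict_mem measurableSet_Ioi] with u hu
    have hu0 : 0 < u := zero_lt_one.trans hu
    rw [Real.norm_of_nonneg (by positivity)]
    refine mul_le_of_le_one_right (by positivity) (Real.sqrt_le_one.mpr ?_)
    rw [div_le_one (by positivity)]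
    linarith

theorem integral_Ioi_rpow_mul_comp_mul_sq (φ : ℝ → ℝ) (β : ℝ) {σ : ℝ} (hσ : 0 < σ) :
    ∫ t in Set.Ioi (0 : ℝ), t ^ (β - 1) * φ (σ ^ 2 * t) =
      σ ^ (-(2 * β)) * ∫ u in Set.Ioi (0 : ℝ), u ^ (β - 1) * φ u := by
  have h := integral_comp_mul_left_Ioi' (fun u : ℝ => u ^ (β - 1) * φ u) 0 (b := σ ^ 2)
    (by positivity)
  rw [mul_zero] at h
  rw [← h, smul_eq_mul, ← integral_const_mul, ← integral_const_mul]
  refine setIntegral_congr_fun measurableSet_Ioi fun t ht => ?_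
  have ht : 0 < t := ht
  have h2 : σ ^ (-(2 * β)) * σ ^ 2 * (σ ^ 2) ^ (β - 1) = 1 := by
    rw [← Real.rpow_natCast σ 2, ← Real.rpow_mul hσ.le, ← Real.rpow_add hσ, ← Real.rpow_add hσ]
    norm_num
    ring_nf
    simp
  simp only [Real.mul_rpow (sq_nonneg σ) ht.le]
  linear_combination -(t ^ (β - 1) * φ (σ ^ 2 * t)) * h2

theorem integrableOn_Ioi_rpow_mul_comp_mul_sq {φ : ℝ → ℝ} {β σ : ℝ} (hσ : 0 < σ)
    (h : IntegrableOn (fun u : ℝ => u ^ (β - 1) * φ u) (Set.Ioi 0)) :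
    IntegrableOn (fun t : ℝ => t ^ (β - 1) * φ (σ ^ 2 * t)) (Set.Ioi 0) := by
  have hσ2 : 0 < σ ^ 2 := by positivity
  rw [← mul_zero (σ ^ 2), ← integrableOn_Ioi_comp_mul_left_iff _ _ hσ2] at h
  refine IntegrableOn.congr_fun (h.const_mul ((σ ^ 2) ^ (β - 1))⁻¹) (fun t ht => ?_)
    measurableSet_Ioi
  have ht : 0 < t := ht
  simp only [Real.mul_rpow hσ2.le ht.le]
  have : (σ ^ 2) ^ (β - 1) ≠ 0 := by positivity
  field_simp

theorem sqrt_pi_div_one_add_mul_sq {t a : ℝ} (ht : 0 < t) (ha : 0 < a) :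
    √(Real.pi / (1 + t * a ^ 2)) =
      √Real.pi * (a⁻¹ * (√t)⁻¹ * √(a ^ 2 * t / (1 + a ^ 2 * t))) := by
  rw [Real.sqrt_div Real.pi_pos.le, Real.sqrt_div (by positivity), Real.sqrt_mul (sq_nonneg a),
    Real.sqrt_sq ha.le, mul_comm t]
  have := Real.sqrt_pos.mpr ht
  field_simp

section WeightedProduct

variable {ι : Type*} [Fintype ι] [DecidableEq ι] (K : Finset ι) {s : ι → ℝ} {t : ℝ}

theorem prod_sqrt_pi_div_one_add_mul_sq (hs : ∀ i, 0 < s i) (ht : 0 < t) :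
    ∏ i, √(Real.pi / (1 + t * s i ^ 2)) =
      √Real.pi ^ Fintype.card ι * (∏ i ∈ K, s i)⁻¹ * (√t)⁻¹ ^ #K *
        ((∏ i ∈ K, √(s i ^ 2 * t / (1 + s i ^ 2 * t))) *
          ∏ i ∈ Kᶜ, √(1 / (1 + s i ^ 2 * t))) := by
  have h₁ : ∏ i ∈ K, √(Real.pi / (1 + t * s i ^ 2)) =
      √Real.pi ^ #K * ((∏ i ∈ K, s i)⁻¹ * (√t)⁻¹ ^ #K *
        ∏ i ∈ K, √(s i ^ 2 * t / (1 + s i ^ 2 * t))) := by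
    rw [prod_congr rfl fun i _ => sqrt_pi_div_one_add_mul_sq ht (hs i)]
    simp only [prod_mul_distrib, prod_const, prod_inv_distrib]
  have h₂ : ∏ i ∈ Kᶜ, √(Real.pi / (1 + t * s i ^ 2)) =
      √Real.pi ^ #Kᶜ * ∏ i ∈ Kᶜ, √(1 / (1 + s i ^ 2 * t)) := by
    rw [← prod_const, ← prod_mul_distrib]
    refine prod_congr rfl fun i _ => ?_
    rw [← Real.sqrt_mul Real.pi_pos.le, mul_one_div, mul_comm t]
  rw [← prod_mul_prod_compl K, h₁, h₂, ← card_add_card_compl K, pow_add]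
  ring

theorem sqrt_div_one_add_le_one {u : ℝ} (hu : 0 ≤ u) : √(u / (1 + u)) ≤ 1 := by
  rw [Real.sqrt_le_one, div_le_one (by positivity)]
  linarith

theorem prod_sqrt_pi_div_le {K : Finset ι} {j : ι} (hj : j ∈ K) (hs : ∀ i, 0 < s i)
    (ht : 0 < t) :
    ∏ i, √(Real.pi / (1 + t * s i ^ 2)) ≤
      √Real.pi ^ Fintype.card ι * (∏ i ∈ K, s i)⁻¹ * (√t)⁻¹ ^ #K *
        √(s j ^ 2 * t / (1 + s j ^ 2 * t)) := by
  have hP : 0 < ∏ i ∈ K, s i := prod_pos fun i _ => hs i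
  have h₁ : ∏ i ∈ K, √(s i ^ 2 * t / (1 + s i ^ 2 * t)) ≤ √(s j ^ 2 * t / (1 + s j ^ 2 * t)) := by
    rw [← mul_prod_erase K _ hj]
    exact mul_le_of_le_one_right (by positivity) <| prod_le_one (fun i _ => by positivity)
      fun i _ => sqrt_div_one_add_le_one (by positivity)
  have h₂ : ∏ i ∈ Kᶜ, √(1 / (1 + s i ^ 2 * t)) ≤ 1 := by
    refine prod_le_one (fun i _ => by positivity) fun i _ => ?_
    rw [Real.sqrt_le_one, div_le_one (by positivity), le_add_iff_nonneg_right]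
    positivity
  rw [prod_sqrt_pi_div_one_add_mul_sq K hs ht]
  gcongr
  exact (mul_le_of_le_one_right (by positivity) h₂).trans h₁

theorem le_prod_sqrt_pi_div {j : ι} (hs : ∀ i, 0 < s i) (hK : ∀ i ∈ K, s j ≤ s i)
    (hK' : ∀ i ∉ K, s i ≤ s j) (ht : 0 < t) :
    √Real.pi ^ Fintype.card ι * (∏ i ∈ K, s i)⁻¹ * (√t)⁻¹ ^ #K *
        (√(s j ^ 2 * t / (1 + s j ^ 2 * t)) ^ #K * √(1 / (1 + s j ^ 2 * t)) ^ #Kᶜ) ≤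
      ∏ i, √(Real.pi / (1 + t * s i ^ 2)) := by
  have hP : 0 < ∏ i ∈ K, s i := prod_pos fun i _ => hs i
  have hj := hs j
  rw [prod_sqrt_pi_div_one_add_mul_sq K hs ht]
  refine mul_le_mul_of_nonneg_left (mul_le_mul
    ((prod_const _).symm.trans_le (prod_le_prod (fun i _ => by positivity) fun i hi => ?_))
    ((prod_const _).symm.trans_le (prod_le_prod (fun i _ => by positivity) fun i hi => ?_))
    (by positivity) (by positivity)) (by positivity)
  · have hsi := hs i
    have hle : s j ^ 2 * t ≤ s i ^ 2 * t := by
      gcongr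
      exact hK i hi
    refine Real.sqrt_le_sqrt ?_
    rw [div_le_div_iff₀ (by positivity) (by positivity)]
    linarith
  · have := (hs i).le
    gcongr
    exact hK' i (mem_compl.mp hi)

end WeightedProduct

theorem exists_lintegral_Ioi_prod_bounds {ι : Type*} [Fintype ι] [DecidableEq ι] (K : Finset ι)
    {α : ℝ} (hα : #K - 1 < α) (hα' : α < #K) (hK : K.Nonempty) :
    ∃ c C : ℝ, 0 < c ∧ 0 < C ∧ ∀ s : ι → ℝ, (∀ i, 0 < s i) →
      ∀ j ∈ K, (∀ i ∈ K, s j ≤ s i) → (∀ i ∉ K, s i ≤ s j) →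
        ∃ J : ℝ, ∫⁻ t in Set.Ioi (0 : ℝ),
            ENNReal.ofReal (t ^ (α / 2 - 1) * ∏ i, √(Real.pi / (1 + t * s i ^ 2))) =
              ENNReal.ofReal J ∧
          c / ((∏ i ∈ K, s i) * s j ^ (α - #K)) ≤ J ∧
          J ≤ C / ((∏ i ∈ K, s i) * s j ^ (α - #K)) := by
  set β : ℝ := (α - #K) / 2 with hβ
  set φ : ℝ → ℝ := fun u => √(u / (1 + u)) with hφ
  set ψ : ℝ → ℝ := fun u => √(u / (1 + u)) ^ #K * √(1 / (1 + u)) ^ #Kᶜ with hψ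
  have hφint : IntegrableOn (fun u : ℝ => u ^ (β - 1) * φ u) (Set.Ioi 0) :=
    integrableOn_Ioi_rpow_mul_sqrt (by linarith) (by linarith)
  have hψφ : ∀ u, 0 < u → ψ u ≤ φ u := fun u hu => by
    have h₂ : √(1 / (1 + u)) ≤ 1 := by
      rw [Real.sqrt_le_one, div_le_one (by positivity)]
      linarith
    have h₁ := sqrt_div_one_add_le_one hu.le
    calc ψ u ≤ √(u / (1 + u)) ^ #K :=
          mul_le_of_le_one_right (by positivity) (pow_le_one₀ (by positivity) h₂)
      _ ≤ φ u := pow_le_of_le_one (by positivity) h₁ hK.card_pos.ne'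
  have hψint : IntegrableOn (fun u : ℝ => u ^ (β - 1) * ψ u) (Set.Ioi 0) := by
    refine hφint.mono' (by fun_prop) ?_
    filter_upwards [ae_restrict_mem measurableSet_Ioi] with u hu
    have hu : 0 < u := hu
    rw [Real.norm_of_nonneg (by positivity)]
    gcongr
    exact hψφ u hu
  have hψpos : 0 < ∫ u in Set.Ioi (0 : ℝ), u ^ (β - 1) * ψ u := by
    rw [setIntegral_pos_iff_support_of_nonneg_ae _ hψint]
    · have : Set.Ioi (0 : ℝ) ⊆ Function.support fun u : ℝ => u ^ (β - 1) * ψ u := fun u hu => by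
        have hu : 0 < u := hu
        exact ne_of_gt (by positivity)
      rw [Set.inter_eq_self_of_subset_right this]
      simp
    · filter_upwards [ae_restrict_mem measurableSet_Ioi] with u hu
      have hu : 0 < u := hu
      simp only [Pi.zero_apply]
      positivity
  have hφpos : 0 < ∫ u in Set.Ioi (0 : ℝ), u ^ (β - 1) * φ u := by
    refine hψpos.trans_le (setIntegral_mono_on hψint hφint measurableSet_Ioi fun u hu => ?_)
    have hu : 0 < u := hu
    gcongr
    exact hψφ u hu
  have hπ : 0 < √Real.pi ^ Fintype.card ι := by positivity
  refine ⟨_, _, mul_pos hπ hψpos, mul_pos hπ hφpos, fun s hs j hj hsK hsK' => ?_⟩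
  have hP : 0 < ∏ i ∈ K, s i := prod_pos fun i _ => hs i
  have hj0 := hs j
  have htpow : ∀ t : ℝ, 0 < t → t ^ (α / 2 - 1) * (√t)⁻¹ ^ #K = t ^ (β - 1) := fun t ht => by
    rw [Real.sqrt_eq_rpow, ← Real.rpow_neg ht.le, ← Real.rpow_mul_natCast ht.le,
      ← Real.rpow_add ht, hβ]
    ring_nf
  have hscale : ∀ f : ℝ → ℝ, ∫ t in Set.Ioi (0 : ℝ),
      (√Real.pi ^ Fintype.card ι * (∏ i ∈ K, s i)⁻¹) * (t ^ (β - 1) * f (s j ^ 2 * t)) =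
      (√Real.pi ^ Fintype.card ι * ∫ u in Set.Ioi (0 : ℝ), u ^ (β - 1) * f u) /
        ((∏ i ∈ K, s i) * s j ^ (α - #K)) := fun f => by
    rw [integral_const_mul, integral_Ioi_rpow_mul_comp_mul_sq f β hj0, Real.rpow_neg hj0.le,
      show 2 * β = α - #K by rw [hβ]; ring]
    have : s j ^ (α - #K) ≠ 0 := by positivity
    field_simp
  have hupper : ∀ t ∈ Set.Ioi (0 : ℝ),
      t ^ (α / 2 - 1) * ∏ i, √(Real.pi / (1 + t * s i ^ 2)) ≤
      (√Real.pi ^ Fintype.card ι * (∏ i ∈ K, s i)⁻¹) * (t ^ (β - 1) * φ (s j ^ 2 * t)) :=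
    fun t (ht : 0 < t) => by
      refine (mul_le_mul_of_nonneg_left (prod_sqrt_pi_div_le hj hs ht) (by positivity)).trans_eq ?_
      rw [← htpow t ht]
      ring
  have hlower : ∀ t ∈ Set.Ioi (0 : ℝ),
      (√Real.pi ^ Fintype.card ι * (∏ i ∈ K, s i)⁻¹) * (t ^ (β - 1) * ψ (s j ^ 2 * t)) ≤
      t ^ (α / 2 - 1) * ∏ i, √(Real.pi / (1 + t * s i ^ 2)) :=
    fun t (ht : 0 < t) => by
      refine Eq.trans_le ?_ (mul_le_mul_of_nonneg_left (le_prod_sqrt_pi_div K hs hsK hsK' ht)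
        (by positivity))
      rw [← htpow t ht]
      ring
  have hφs := (integrableOn_Ioi_rpow_mul_comp_mul_sq hj0 hφint).const_mul
    (√Real.pi ^ Fintype.card ι * (∏ i ∈ K, s i)⁻¹)
  have hψs := (integrableOn_Ioi_rpow_mul_comp_mul_sq hj0 hψint).const_mul
    (√Real.pi ^ Fintype.card ι * (∏ i ∈ K, s i)⁻¹)
  have hnonneg : ∀ t ∈ Set.Ioi (0 : ℝ),
      0 ≤ t ^ (α / 2 - 1) * ∏ i, √(Real.pi / (1 + t * s i ^ 2)) := fun t (ht : 0 < t) => by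
    positivity
  have hint : IntegrableOn
      (fun t : ℝ => t ^ (α / 2 - 1) * ∏ i, √(Real.pi / (1 + t * s i ^ 2))) (Set.Ioi 0) := by
    refine hφs.mono' (by fun_prop) ?_
    filter_upwards [ae_restrict_mem measurableSet_Ioi] with t ht
    rw [Real.norm_of_nonneg (hnonneg t ht)]
    exact hupper t ht
  refine ⟨_, (ofReal_integral_eq_lintegral_ofReal hint ?_).symm, ?_, ?_⟩
  · filter_upwards [ae_restrict_mem measurableSet_Ioi] with t ht using hnonneg t ht
  · rw [← hscale]
    exact setIntegral_mono_on hψs hint measurableSet_Ioi hlower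
  · rw [← hscale]
    exact setIntegral_mono_on hint hφs measurableSet_Ioi hupper

theorem norm_diagonal_mulVec_rpow {n : ℕ} (s : Fin n → ℝ) (α : ℝ)
    (x : EuclideanSpace ℝ (Fin n)) :
    ‖(EuclideanSpace.equiv (Fin n) ℝ).symm ((Matrix.diagonal s).mulVec x)‖ ^ (-α) =
      (∑ i, (s i * x i) ^ 2) ^ (-(α / 2)) := by
  rw [EuclideanSpace.norm_eq, Real.sqrt_eq_rpow, ← Real.rpow_mul (by positivity)]
  simp only [Real.norm_eq_abs, sq_abs]
  simp [Matrix.mulVec_diagonal]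
  ring_nf

theorem exists_integral_sphere_bounds {n : ℕ} {α : ℝ} (hα0 : 0 < α) (hαn : α < n)
    (K : Finset (Fin n)) (hα : #K - 1 < α) (hα' : α < #K) :
    ∃ c C : ℝ, 0 < c ∧ 0 < C ∧ ∀ s : Fin n → ℝ, (∀ i, 0 < s i) →
      ∀ j ∈ K, (∀ i ∈ K, s j ≤ s i) → (∀ i ∉ K, s i ≤ s j) →
        c / ((∏ i ∈ K, s i) * s j ^ (α - #K)) ≤
          (∫ x : sphere (0 : EuclideanSpace ℝ (Fin n)) 1,
            ‖(EuclideanSpace.equiv (Fin n) ℝ).symm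
              ((Matrix.diagonal s).mulVec (x : EuclideanSpace ℝ (Fin n)))‖ ^ (-α)
            ∂(volume : Measure (EuclideanSpace ℝ (Fin n))).toSphere) ∧
        (∫ x : sphere (0 : EuclideanSpace ℝ (Fin n)) 1,
            ‖(EuclideanSpace.equiv (Fin n) ℝ).symm
              ((Matrix.diagonal s).mulVec (x : EuclideanSpace ℝ (Fin n)))‖ ^ (-α)
            ∂(volume : Measure (EuclideanSpace ℝ (Fin n))).toSphere) ≤
          C / ((∏ i ∈ K, s i) * s j ^ (α - #K)) := by
  have hKne : K.Nonempty := card_pos.mp (by exact_mod_cast hα0.trans hα')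
  obtain ⟨c, C, hc, hC, H⟩ := exists_lintegral_Ioi_prod_bounds K hα hα' hKne
  set κ : ℝ := Real.Gamma (α / 2) * (1 / 2 * Real.Gamma ((n - α) / 2)) with hκ
  have hκ0 : 0 < κ := by
    have h₁ := Real.Gamma_pos_of_pos (half_pos hα0)
    have h₂ := Real.Gamma_pos_of_pos (half_pos (sub_pos.mpr hαn))
    positivity
  refine ⟨c / κ, C / κ, by positivity, by positivity, fun s hs j hj hsK hsK' => ?_⟩
  obtain ⟨J, hJ, hcJ, hJC⟩ := H s hs j hj hsK hsK'
  have hD : 0 < (∏ i ∈ K, s i) * s j ^ (α - #K) :=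
    mul_pos (prod_pos fun i _ => hs i) (Real.rpow_pos_of_pos (hs j) _)
  have hJ0 : 0 ≤ J := le_trans (by positivity) hcJ
  rw [← Gamma_mul_lintegral_sphere_weighted_rpow hα0 hαn hs] at hJ
  simp only [norm_diagonal_mulVec_rpow]
  have hI : ∫ x : sphere (0 : EuclideanSpace ℝ (Fin n)) 1,
      (∑ i, (s i * (x : EuclideanSpace ℝ (Fin n)) i) ^ 2) ^ (-(α / 2))
      ∂(volume : Measure (EuclideanSpace ℝ (Fin n))).toSphere = J / κ := by
    rw [integral_eq_lintegral_of_nonneg_ae (.of_forall fun x => by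
      simp only [Pi.zero_apply]; positivity) (Measurable.aestronglyMeasurable (by fun_prop)),
      eq_div_iff hκ0.ne']
    have hJ' := congrArg ENNReal.toReal hJ
    rwa [ENNReal.toReal_mul, ENNReal.toReal_ofReal hκ0.le, ENNReal.toReal_ofReal hJ0,
      mul_comm] at hJ'
  rw [hI, div_right_comm, div_right_comm C]
  exact ⟨by gcongr, by gcongr⟩

/-- Non-integer case `0 < α < n` of the key integral estimate: for
`A = diag(s₁,…,sₙ)` with `s₁ ≥ ⋯ ≥ sₙ > 0`,
`∫_{S^{n-1}} |Ax|^{-α} dx ≈ 1/(s₁⋯s_{⌈α⌉} · s_{⌈α⌉}^{α-⌈α⌉})`,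
with constants depending only on `n` and `α`. -/
theorem integral_estimate_noninteger (n : ℕ) (α : ℝ) (hα0 : 0 < α) (hαn : α < n)
    (hni : ∀ m : ℤ, α ≠ m) :
    ∃ c C : ℝ, 0 < c ∧ 0 < C ∧
      ∀ s : Fin n → ℝ, (∀ i, 0 < s i) → (∀ i j : Fin n, i ≤ j → s j ≤ s i) →
        c / ((∏ i ∈ Finset.univ.filter (fun i : Fin n => (i : ℕ) < ⌈α⌉₊), s i) *
              s ⟨⌈α⌉₊ - 1, by
                have h1 : ⌈α⌉₊ ≤ n := Nat.ceil_le.mpr hαn.le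
                have h2 : 0 < ⌈α⌉₊ := Nat.ceil_pos.mpr hα0
                omega⟩ ^ (α - ⌈α⌉₊)) ≤
          (∫ x : sphere (0 : EuclideanSpace ℝ (Fin n)) 1,
            ‖(EuclideanSpace.equiv (Fin n) ℝ).symm
              ((Matrix.diagonal s).mulVec (x : EuclideanSpace ℝ (Fin n)))‖ ^ (-α)
            ∂(volume : Measure (EuclideanSpace ℝ (Fin n))).toSphere) ∧
        (∫ x : sphere (0 : EuclideanSpace ℝ (Fin n)) 1,
            ‖(EuclideanSpace.equiv (Fin n) ℝ).symm
              ((Matrix.diagonal s).mulVec (x : EuclideanSpace ℝ (Fin n)))‖ ^ (-α)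
            ∂(volume : Measure (EuclideanSpace ℝ (Fin n))).toSphere) ≤
          C / ((∏ i ∈ Finset.univ.filter (fun i : Fin n => (i : ℕ) < ⌈α⌉₊), s i) *
              s ⟨⌈α⌉₊ - 1, by
                have h1 : ⌈α⌉₊ ≤ n := Nat.ceil_le.mpr hαn.le
                have h2 : 0 < ⌈α⌉₊ := Nat.ceil_pos.mpr hα0
                omega⟩ ^ (α - ⌈α⌉₊)) := by
  have hk0 : 0 < ⌈α⌉₊ := Nat.ceil_pos.mpr hα0
  have hkn : ⌈α⌉₊ ≤ n := Nat.ceil_le.mpr hαn.le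
  have hcard : #(univ.filter fun i : Fin n => (i : ℕ) < ⌈α⌉₊) = ⌈α⌉₊ := by
    rw [Fin.card_filter_val_lt, min_eq_right hkn]
  have hlt : α < ⌈α⌉₊ :=
    lt_of_le_of_ne (Nat.le_ceil α) fun h => hni ⌈α⌉₊ (by exact_mod_cast h)
  obtain ⟨c, C, hc, hC, H⟩ := exists_integral_sphere_bounds hα0 hαn
    (univ.filter fun i : Fin n => (i : ℕ) < ⌈α⌉₊)
    (by rw [hcard]; linarith [Nat.ceil_lt_add_one hα0.le]) (by rwa [hcard])
  rw [hcard] at H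
  refine ⟨c, C, hc, hC, fun s hs hmono => H s hs _ (by simp; omega) (fun i hi => ?_) fun i hi => ?_⟩
  · refine hmono _ _ (Fin.le_def.mpr ?_)
    simp only [mem_filter, mem_univ, true_and] at hi
    simp only
    omega
  · refine hmono _ _ (Fin.le_def.mpr ?_)
    simp only [mem_filter, mem_univ, true_and] at hi
    simp only
    omega
end

section
/- Let A = diag(s_1,…,s_n) with s_1 ≥ … ≥ s_n > 0, and let α be an integer with 0 < α < n. Then there exist constants c, C > 0 depending only on n and α such that c·(1+log(s_α/s_{α+1}))/(s_1⋯s_α) ≤ ∫_{S^{n-1}} |Ax|^{-α} dx ≤ C·(1+log(s_α/s_{α+1}))/(s_1⋯s_α). -/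
open MeasureTheory Metric Finset

theorem lintegral_Ioi_mul_rpow {a M : ℝ} (ha : 0 < a) (hM : 0 < M) :
    ∫⁻ t in Set.Ioi M, ENNReal.ofReal (a * t ^ (-a - 1)) = ENNReal.ofReal (M ^ (-a)) := by
  rw [← ofReal_integral_eq_lintegral_ofReal]
  · rw [integral_const_mul, integral_Ioi_rpow_of_lt (by linarith) hM]
    congr 1
    rw [sub_add_cancel]
    field_simp
  · exact (integrableOn_Ioi_rpow_of_lt (by linarith) hM).const_mul a
  · filter_upwards [ae_restrict_mem measurableSet_Ioi] with t ht
    have : 0 < t := hM.trans ht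
    positivity

theorem lintegral_rpow_neg_eq_lintegral_meas_lt {X : Type*} [MeasurableSpace X]
    (μ : Measure X) [SFinite μ] {f : X → ℝ} (hf : Measurable f) (hpos : ∀ᵐ x ∂μ, 0 < f x)
    {a : ℝ} (ha : 0 < a) :
    ∫⁻ x, ENNReal.ofReal (f x ^ (-a)) ∂μ =
      ∫⁻ t in Set.Ioi (0 : ℝ), ENNReal.ofReal (a * t ^ (-a - 1)) * μ {x | f x < t} := by
  have hmeas : Measurable (fun t : ℝ => ENNReal.ofReal (a * t ^ (-a - 1))) := by fun_prop
  have hlt : MeasurableSet {p : X × ℝ | f p.1 < p.2} :=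
    measurableSet_lt (hf.comp measurable_fst) measurable_snd
  calc ∫⁻ x, ENNReal.ofReal (f x ^ (-a)) ∂μ
      = ∫⁻ x, (∫⁻ t in Set.Ioi (0 : ℝ), {p : X × ℝ | f p.1 < p.2}.indicator
          (fun p => ENNReal.ofReal (a * p.2 ^ (-a - 1))) (x, t)) ∂μ := by
        refine lintegral_congr_ae ?_
        filter_upwards [hpos] with x hx
        rw [← lintegral_Ioi_mul_rpow ha hx, ← Set.inter_eq_self_of_subset_left
          (Set.Ioi_subset_Ioi hx.le), ← Measure.restrict_restrict measurableSet_Ioi,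
          ← lintegral_indicator measurableSet_Ioi]
        rfl
    _ = ∫⁻ t in Set.Ioi (0 : ℝ), ∫⁻ x, {p : X × ℝ | f p.1 < p.2}.indicator
          (fun p => ENNReal.ofReal (a * p.2 ^ (-a - 1))) (x, t) ∂μ := by
        refine lintegral_lintegral_swap (Measurable.aemeasurable ?_)
        exact (hmeas.comp measurable_snd).indicator hlt
    _ = _ := by
        refine lintegral_congr fun t => ?_
        rw [← lintegral_indicator_const (measurableSet_lt hf measurable_const)]
        rfl

theorem setLIntegral_ball_eq_toSphere {E : Type*} [NormedAddCommGroup E] [NormedSpace ℝ E]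
    [FiniteDimensional ℝ E] [MeasurableSpace E] [BorelSpace E] [Nontrivial E]
    (μ : Measure E) [μ.IsAddHaarMeasure] {a : ℝ} (ha : a < Module.finrank ℝ E)
    {f : E → ENNReal} (hf : Measurable f)
    (hhom : ∀ r : ℝ, 0 < r → ∀ x, f (r • x) = ENNReal.ofReal (r ^ (-a)) * f x) :
    ∫⁻ x in ball (0 : E) 1, f x ∂μ =
      ENNReal.ofReal (1 / (Module.finrank ℝ E - a)) * ∫⁻ u : sphere (0 : E) 1, f u ∂μ.toSphere := by
  have hpos : 0 < Module.finrank ℝ E := Module.finrank_pos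
  set d := Module.finrank ℝ E
  set g : E → ENNReal := (ball (0 : E) 1).indicator f with hg
  have hpolar : ∀ p : sphere (0 : E) 1 × Set.Ioi (0 : ℝ), g (p.2.1 • p.1.1) =
      f p.1.1 * (Set.Iio (1 : ℝ)).indicator (fun r => ENNReal.ofReal (r ^ (-a))) p.2.1 := by
    rintro ⟨⟨u, hu⟩, r, hr⟩
    have hr' : 0 < r := hr
    have hu' : ‖u‖ = 1 := by simpa using hu
    by_cases h1 : r < 1
    · have : r • u ∈ ball (0 : E) 1 := by simp [norm_smul, hu', abs_of_pos hr', h1]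
      simp [hg, this, h1, hhom r hr', mul_comm]
    · have : r • u ∉ ball (0 : E) 1 := by simpa [norm_smul, hu', abs_of_pos hr'] using h1
      simp [hg, this, h1]
  have hφ : Measurable fun r : Set.Ioi (0 : ℝ) => (Set.Iio (1 : ℝ)).indicator
      (fun r => ENNReal.ofReal (r ^ (-a))) r.1 :=
    Measurable.comp (g := (Set.Iio (1 : ℝ)).indicator (fun r => ENNReal.ofReal (r ^ (-a))))
      (Measurable.indicator (by fun_prop) measurableSet_Iio) measurable_subtype_coe
  have hrad : ∫⁻ r : Set.Ioi (0 : ℝ), (Set.Iio (1 : ℝ)).indicator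
      (fun r => ENNReal.ofReal (r ^ (-a))) r.1 ∂Measure.volumeIoiPow (d - 1) =
      ENNReal.ofReal (1 / (d - a)) := by
    rw [Measure.volumeIoiPow, lintegral_withDensity_eq_lintegral_mul _ (by fun_prop) hφ]
    have : ∀ r : Set.Ioi (0 : ℝ), ((fun r : Set.Ioi (0 : ℝ) => ENNReal.ofReal (r.1 ^ (d - 1))) *
        fun r : Set.Ioi (0 : ℝ) => (Set.Iio (1 : ℝ)).indicator
          (fun r => ENNReal.ofReal (r ^ (-a))) r.1) r =
        (fun r : ℝ => (Set.Iio (1 : ℝ)).indicator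
          (fun r => ENNReal.ofReal (r ^ (d - 1 - a))) r) r.1 := by
      rintro ⟨r, hr⟩
      have hr' : 0 < r := hr
      by_cases h1 : r < 1
      · simp only [Pi.mul_apply, Set.mem_Iio, h1, Set.indicator_of_mem]
        rw [← ENNReal.ofReal_mul (by positivity), ← Real.rpow_natCast, ← Real.rpow_add hr',
          Nat.cast_pred hpos]
        rfl
      · simp [h1]
    rw [lintegral_congr this, lintegral_subtype_comap measurableSet_Ioi,
      lintegral_indicator measurableSet_Iio, Measure.restrict_restrict measurableSet_Iio,
      Set.Iio_inter_Ioi, Measure.restrict_congr_set Ioo_ae_eq_Ioc, ← ofReal_integral_eq_lintegral_ofReal,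
      ← intervalIntegral.integral_of_le zero_le_one, integral_rpow (Or.inl (by linarith))]
    · rw [sub_right_comm, sub_add_cancel, Real.zero_rpow (by linarith), Real.one_rpow, sub_zero]
    · exact (intervalIntegral.intervalIntegrable_rpow' (by linarith)).1
    · filter_upwards [ae_restrict_mem measurableSet_Ioc] with y hy
      exact Real.rpow_nonneg hy.1.le _
  calc ∫⁻ x in ball (0 : E) 1, f x ∂μ = ∫⁻ x, g x ∂μ :=
        (lintegral_indicator measurableSet_ball _).symm
    _ = ∫⁻ x : ({(0)}ᶜ : Set E), g x ∂(μ.comap (↑)) := by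
        rw [lintegral_subtype_comap (measurableSet_singleton _).compl, restrict_compl_singleton]
    _ = ∫⁻ p, g (p.2.1 • p.1.1) ∂(μ.toSphere.prod (.volumeIoiPow (d - 1))) := by
        rw [← μ.measurePreserving_homeomorphUnitSphereProd.lintegral_comp_emb
          (Homeomorph.measurableEmbedding _)]
        refine lintegral_congr fun x => ?_
        congr 1
        exact congrArg Subtype.val ((homeomorphUnitSphereProd E).symm_apply_apply x).symm
    _ = _ := by
        rw [lintegral_congr hpolar, lintegral_prod_mul (f := fun u : sphere (0 : E) 1 => f u.1)
          (g := fun r : Set.Ioi (0 : ℝ) => (Set.Iio (1 : ℝ)).indicator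
            (fun r => ENNReal.ofReal (r ^ (-a))) r.1), hrad, mul_comm]
        · exact (hf.comp measurable_subtype_coe).aemeasurable
        · exact hφ.aemeasurable

theorem lintegral_Ioc_inv {b c : ℝ} (hb : 0 < b) (hbc : b ≤ c) :
    ∫⁻ t in Set.Ioc b c, ENNReal.ofReal t⁻¹ = ENNReal.ofReal (Real.log (c / b)) := by
  rw [← ofReal_integral_eq_lintegral_ofReal, ← intervalIntegral.integral_of_le hbc,
    integral_inv_of_pos hb (hb.trans_le hbc)]
  · refine (intervalIntegral.intervalIntegrable_inv (fun x hx => ?_) continuousOn_id).1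
    rw [Set.uIcc_of_le hbc] at hx
    exact (hb.trans_le hx.1).ne'
  · filter_upwards [ae_restrict_mem measurableSet_Ioc] with t ht
    exact inv_nonneg.2 (hb.trans ht.1).le

theorem rpow_neg_sub_one_mul_pow {t : ℝ} (ht : 0 < t) (a k : ℕ) :
    t ^ (-(a : ℝ) - 1) * t ^ k = t ^ ((k : ℝ) - a - 1) := by
  rw [← Real.rpow_natCast t k, ← Real.rpow_add ht]
  congr 1
  ring

theorem lintegral_rpow_mul_le {a : ℕ} (ha : 0 < a) {b c p : ℝ} (hb : 0 < b) (hbc : b ≤ c)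
    (hp : 0 < p) {P : ℝ → ℝ} (h₁ : ∀ t, 0 < t → P t ≤ t ^ (a + 1) / (p * b))
    (h₂ : ∀ t, 0 < t → P t ≤ t ^ a / p) (h₃ : ∀ t, 0 < t → P t ≤ t ^ (a - 1) * c / p) :
    ∫⁻ t in Set.Ioi (0 : ℝ), ENNReal.ofReal (a * t ^ (-(a : ℝ) - 1) * P t) ≤
      ENNReal.ofReal (a / p * (2 + Real.log (c / b))) := by
  have hc : 0 < c := hb.trans_le hbc
  have hlog : 0 ≤ Real.log (c / b) := Real.log_nonneg ((one_le_div hb).2 hbc)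
  have ha' : (0 : ℝ) < a := Nat.cast_pos.2 ha
  have e₁ : ∫⁻ t in Set.Ioc 0 b, ENNReal.ofReal (a * t ^ (-(a : ℝ) - 1) * P t) ≤
      ENNReal.ofReal (a / p) := by
    calc _ ≤ ∫⁻ t in Set.Ioc 0 b, ENNReal.ofReal (a / (p * b)) := by
          refine setLIntegral_mono measurable_const fun t ht => ENNReal.ofReal_le_ofReal ?_
          have h0 := ht.1
          calc _ ≤ a * t ^ (-(a : ℝ) - 1) * (t ^ (a + 1) / (p * b)) := by gcongr; exact h₁ t h0
            _ = a * (t ^ (-(a : ℝ) - 1) * t ^ (a + 1)) / (p * b) := by ring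
            _ = _ := by rw [rpow_neg_sub_one_mul_pow h0]; simp
      _ = _ := by
          rw [setLIntegral_const, Real.volume_Ioc, sub_zero, ← ENNReal.ofReal_mul (by positivity)]
          congr 1
          field_simp
  have e₂ : ∫⁻ t in Set.Ioc b c, ENNReal.ofReal (a * t ^ (-(a : ℝ) - 1) * P t) ≤
      ENNReal.ofReal (a / p * Real.log (c / b)) := by
    calc _ ≤ ∫⁻ t in Set.Ioc b c, ENNReal.ofReal (a / p) * ENNReal.ofReal t⁻¹ := by
          refine setLIntegral_mono (by fun_prop) fun t ht => ?_
          have h0 := hb.trans ht.1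
          rw [← ENNReal.ofReal_mul (by positivity)]
          refine ENNReal.ofReal_le_ofReal ?_
          calc _ ≤ a * t ^ (-(a : ℝ) - 1) * (t ^ a / p) := by gcongr; exact h₂ t h0
            _ = a / p * (t ^ (-(a : ℝ) - 1) * t ^ a) := by ring
            _ = _ := by rw [rpow_neg_sub_one_mul_pow h0]; simp [Real.rpow_neg_one]
      _ = _ := by
          rw [lintegral_const_mul _ (by fun_prop), lintegral_Ioc_inv hb hbc,
            ← ENNReal.ofReal_mul (by positivity)]
  have e₃ : ∫⁻ t in Set.Ioi c, ENNReal.ofReal (a * t ^ (-(a : ℝ) - 1) * P t) ≤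
      ENNReal.ofReal (a / p) := by
    calc _ ≤ ∫⁻ t in Set.Ioi c,
          ENNReal.ofReal (a * c / p) * ENNReal.ofReal (1 * t ^ (-1 - 1 : ℝ)) := by
          refine setLIntegral_mono (by fun_prop) fun t ht => ?_
          have h0 : 0 < t := hc.trans ht
          rw [← ENNReal.ofReal_mul (by positivity)]
          refine ENNReal.ofReal_le_ofReal ?_
          calc _ ≤ a * t ^ (-(a : ℝ) - 1) * (t ^ (a - 1) * c / p) := by gcongr; exact h₃ t h0
            _ = a * c / p * (t ^ (-(a : ℝ) - 1) * t ^ (a - 1)) := by ring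
            _ = _ := by
              rw [rpow_neg_sub_one_mul_pow h0, Nat.cast_pred ha, one_mul]
              congr 2
              ring
      _ = _ := by
          rw [lintegral_const_mul _ (by fun_prop), lintegral_Ioi_mul_rpow one_pos hc,
            ← ENNReal.ofReal_mul (by positivity), Real.rpow_neg_one]
          congr 1
          field_simp
  calc _ ≤ ENNReal.ofReal (a / p) + (ENNReal.ofReal (a / p * Real.log (c / b)) +
        ENNReal.ofReal (a / p)) := by
        rw [← Set.Ioc_union_Ioi_eq_Ioi hb.le, ← Set.Ioc_union_Ioi_eq_Ioi hbc]
        exact (lintegral_union_le _ _ _).trans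
          (add_le_add e₁ ((lintegral_union_le _ _ _).trans (add_le_add e₂ e₃)))
    _ = _ := by
        rw [← ENNReal.ofReal_add (by positivity) (by positivity),
          ← ENNReal.ofReal_add (by positivity) (by positivity)]
        congr 1
        ring

theorem le_lintegral_rpow_mul {a : ℕ} (ha : 0 < a) {b c p : ℝ} (hb : 0 < b) (hbc : b ≤ c)
    (hp : 0 < p) {P : ℝ → ℝ} (h : ∀ t, b ≤ t → min t c ^ a / p ≤ P t) :
    ENNReal.ofReal (1 / p * (1 + Real.log (c / b))) ≤
      ∫⁻ t in Set.Ioi (0 : ℝ), ENNReal.ofReal (a * t ^ (-(a : ℝ) - 1) * P t) := by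
  have hc : 0 < c := hb.trans_le hbc
  have hlog : 0 ≤ Real.log (c / b) := Real.log_nonneg ((one_le_div hb).2 hbc)
  have ha' : (1 : ℝ) ≤ a := Nat.one_le_cast.2 ha
  have e₂ : ENNReal.ofReal (1 / p * Real.log (c / b)) ≤
      ∫⁻ t in Set.Ioc b c, ENNReal.ofReal (a * t ^ (-(a : ℝ) - 1) * P t) := by
    rw [ENNReal.ofReal_mul (by positivity), ← lintegral_Ioc_inv hb hbc,
      ← lintegral_const_mul _ (by fun_prop)]
    refine setLIntegral_mono' measurableSet_Ioc fun t ht => ?_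
    have h0 := hb.trans ht.1
    rw [← ENNReal.ofReal_mul (by positivity)]
    refine ENNReal.ofReal_le_ofReal ?_
    have hP := h t ht.1.le
    rw [min_eq_left ht.2] at hP
    calc _ = 1 * (t ^ (-(a : ℝ) - 1) * t ^ a) / p := by
          rw [rpow_neg_sub_one_mul_pow h0]
          simp only [sub_self, zero_sub, Real.rpow_neg_one]
          ring
      _ ≤ a * (t ^ (-(a : ℝ) - 1) * t ^ a) / p := by gcongr
      _ = a * t ^ (-(a : ℝ) - 1) * (t ^ a / p) := by ring
      _ ≤ _ := by gcongr
  have e₃ : ENNReal.ofReal (1 / p) ≤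
      ∫⁻ t in Set.Ioi c, ENNReal.ofReal (a * t ^ (-(a : ℝ) - 1) * P t) := by
    calc _ = ENNReal.ofReal (c ^ a / p) *
          ∫⁻ t in Set.Ioi c, ENNReal.ofReal (a * t ^ (-(a : ℝ) - 1)) := by
          rw [lintegral_Ioi_mul_rpow (by positivity) hc, ← ENNReal.ofReal_mul (by positivity),
            Real.rpow_neg hc.le, Real.rpow_natCast]
          congr 1
          field_simp
      _ = ∫⁻ t in Set.Ioi c,
          ENNReal.ofReal (c ^ a / p) * ENNReal.ofReal (a * t ^ (-(a : ℝ) - 1)) :=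
          (lintegral_const_mul _ (by fun_prop)).symm
      _ ≤ _ := by
          refine setLIntegral_mono' measurableSet_Ioi fun t (ht : c < t) => ?_
          have h0 := hc.trans ht
          rw [← ENNReal.ofReal_mul (by positivity), mul_comm]
          refine ENNReal.ofReal_le_ofReal ?_
          have hP := h t (hbc.trans ht.le)
          rw [min_eq_right ht.le] at hP
          gcongr
  calc _ = ENNReal.ofReal (1 / p * Real.log (c / b)) + ENNReal.ofReal (1 / p) := by
        rw [← ENNReal.ofReal_add (by positivity) (by positivity)]
        congr 1
        ring
    _ ≤ _ := add_le_add e₂ e₃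
    _ = ∫⁻ t in Set.Ioi b, ENNReal.ofReal (a * t ^ (-(a : ℝ) - 1) * P t) := by
        rw [← lintegral_union measurableSet_Ioi (Set.Ioc_disjoint_Ioi le_rfl),
          Set.Ioc_union_Ioi_eq_Ioi hbc]
    _ ≤ _ := lintegral_mono_set (Set.Ioi_subset_Ioi hb.le)

theorem prod_min_one_div_le {ι : Type*} [Fintype ι] {s : ι → ℝ} (hs : ∀ i, 0 < s i)
    (S : Finset ι) {t : ℝ} (ht : 0 < t) :
    ∏ i, min 1 (t / s i) ≤ t ^ #S / ∏ i ∈ S, s i := by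
  have h0 : ∀ i, 0 ≤ min 1 (t / s i) := fun i => le_min zero_le_one (div_pos ht (hs i)).le
  calc ∏ i, min 1 (t / s i) ≤ ∏ i ∈ S, min 1 (t / s i) :=
        Finset.prod_le_prod_of_subset_of_le_one (subset_univ S) (fun i _ => h0 i)
          fun i _ _ => min_le_left _ _
    _ ≤ ∏ i ∈ S, t / s i := Finset.prod_le_prod (fun i _ => h0 i) fun i _ => min_le_right _ _
    _ = _ := by rw [Finset.prod_div_distrib, Finset.prod_const]

theorem le_prod_min_one_div {ι : Type*} [Fintype ι] {s : ι → ℝ} (hs : ∀ i, 0 < s i)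
    (S : Finset ι) {t c : ℝ} (ht : 0 < t) (hc : 0 < c) (hS : ∀ i ∈ S, c ≤ s i)
    (hS' : ∀ i ∉ S, s i ≤ t) :
    min t c ^ #S / ∏ i ∈ S, s i ≤ ∏ i, min 1 (t / s i) := by
  classical
  rw [← Finset.prod_subset (subset_univ S) fun i _ hi =>
      min_eq_left ((one_le_div (hs i)).2 (hS' i hi)),
    ← Finset.prod_const, ← Finset.prod_div_distrib]
  refine Finset.prod_le_prod (fun i _ => div_nonneg (le_min ht.le hc.le) (hs i).le) fun i hi => ?_
  refine le_min ?_ ?_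
  · exact (div_le_one (hs i)).2 ((min_le_right _ _).trans (hS i hi))
  · have := (hs i).le
    gcongr
    exact min_le_left _ _

theorem EuclideanSpace.norm_lt_of_forall_abs_lt_div {n : ℕ} (hn : 0 < n)
    {y : EuclideanSpace ℝ (Fin n)} {r : ℝ} (h : ∀ i, |y i| < r / n) : ‖y‖ < r := by
  have : Nonempty (Fin n) := ⟨⟨0, hn⟩⟩
  have hn' : (1 : ℝ) ≤ n := Nat.one_le_cast.2 hn
  have hr : 0 < r := by
    have := (abs_nonneg _).trans_lt (h ⟨0, hn⟩)
    contrapose! this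
    exact div_nonpos_of_nonpos_of_nonneg this (by positivity)
  refine lt_of_pow_lt_pow_left₀ 2 hr.le ?_
  rw [EuclideanSpace.norm_sq_eq]
  calc ∑ i, ‖y i‖ ^ 2 < ∑ _i : Fin n, (r / n) ^ 2 :=
        Finset.sum_lt_sum_of_nonempty univ_nonempty fun i _ =>
          pow_lt_pow_left₀ (h i) (abs_nonneg _) two_ne_zero
    _ = r ^ 2 / n := by
        rw [Finset.sum_const, card_univ, Fintype.card_fin, nsmul_eq_mul]
        field_simp
    _ ≤ r ^ 2 := div_le_self (by positivity) hn'

theorem EuclideanSpace.volume_setOf_forall_abs_lt {n : ℕ} {c : Fin n → ℝ} :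
    volume {x : EuclideanSpace ℝ (Fin n) | ∀ i, |x i| < c i} =
      ∏ i, ENNReal.ofReal (2 * c i) := by
  have : {x : EuclideanSpace ℝ (Fin n) | ∀ i, |x i| < c i} =
      WithLp.ofLp ⁻¹' (Set.univ.pi fun i => Set.Ioo (-c i) (c i)) := by
    ext x
    simp [abs_lt]
  rw [this, (PiLp.volume_preserving_ofLp (Fin n)).measure_preimage
    (MeasurableSet.univ_pi fun i => measurableSet_Ioo).nullMeasurableSet, Real.volume_pi_Ioo]
  congr! 2
  ring

theorem norm_diagonal_mulVec {n : ℕ} (s : Fin n → ℝ) (x : EuclideanSpace ℝ (Fin n)) :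
    ‖(EuclideanSpace.equiv (Fin n) ℝ).symm ((Matrix.diagonal s).mulVec x)‖ =
      ‖WithLp.toLp 2 fun i => s i * x i‖ := by
  congr 1
  ext i
  simp [Matrix.mulVec_diagonal]

theorem volume_ball_inter_le {n : ℕ} {s : Fin n → ℝ} (hs : ∀ i, 0 < s i) {t : ℝ} (ht : 0 < t) :
    volume ({x : EuclideanSpace ℝ (Fin n) | ‖WithLp.toLp 2 fun i => s i * x i‖ < t} ∩ ball 0 1) ≤
      ENNReal.ofReal (2 ^ n * ∏ i, min 1 (t / s i)) := by
  calc _ ≤ volume {x : EuclideanSpace ℝ (Fin n) | ∀ i, |x i| < min 1 (t / s i)} := by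
        refine measure_mono ?_
        rintro x ⟨hx : ‖_‖ < t, hx'⟩ i
        rw [mem_ball_zero_iff] at hx'
        refine lt_min ((PiLp.norm_apply_le x i).trans_lt hx') ?_
        have := (PiLp.norm_apply_le _ i).trans_lt hx
        rw [lt_div_iff₀ (hs i), mul_comm]
        simpa [abs_mul, abs_of_pos (hs i)] using this
    _ = _ := by
        rw [EuclideanSpace.volume_setOf_forall_abs_lt, ← ENNReal.ofReal_prod_of_nonneg,
          Finset.prod_mul_distrib]
        · simp
        · intro i _
          have := hs i
          positivity

theorem le_volume_ball_inter {n : ℕ} (hn : 0 < n) {s : Fin n → ℝ} (hs : ∀ i, 0 < s i) {t : ℝ}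
    (ht : 0 < t) :
    ENNReal.ofReal ((2 / n) ^ n * ∏ i, min 1 (t / s i)) ≤
      volume
        ({x : EuclideanSpace ℝ (Fin n) | ‖WithLp.toLp 2 fun i => s i * x i‖ < t} ∩ ball 0 1) := by
  calc _ = volume {x : EuclideanSpace ℝ (Fin n) | ∀ i, |x i| < min 1 (t / s i) / n} := by
        rw [EuclideanSpace.volume_setOf_forall_abs_lt, ← ENNReal.ofReal_prod_of_nonneg]
        · simp_rw [mul_div_left_comm, mul_comm _ ((2 : ℝ) / n)]
          rw [Finset.prod_mul_distrib]
          simp [div_pow]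
        · intro i _
          have := hs i
          positivity
    _ ≤ _ := by
        refine measure_mono fun x hx => ⟨?_, ?_⟩
        · refine EuclideanSpace.norm_lt_of_forall_abs_lt_div hn fun i => ?_
          have hi := (hx i).trans_le
            (div_le_div_of_nonneg_right (min_le_right _ _) n.cast_nonneg)
          rw [div_right_comm, lt_div_iff₀ (hs i), mul_comm] at hi
          simpa [abs_mul, abs_of_pos (hs i)] using hi
        · rw [mem_ball_zero_iff]
          exact EuclideanSpace.norm_lt_of_forall_abs_lt_div hn fun i => (hx i).trans_le
            (div_le_div_of_nonneg_right (min_le_left _ _) n.cast_nonneg)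

theorem ofReal_mul_lintegral_toSphere_eq {n : ℕ} (a : ℕ) (ha0 : 0 < a) (han : a < n)
    {s : Fin n → ℝ} (hs : ∀ i, 0 < s i) :
    ENNReal.ofReal (1 / (n - a)) * ∫⁻ u : sphere (0 : EuclideanSpace ℝ (Fin n)) 1,
        ENNReal.ofReal (‖WithLp.toLp 2 fun i => s i * u.1 i‖ ^ (-(a : ℝ)))
        ∂(volume : Measure (EuclideanSpace ℝ (Fin n))).toSphere =
      ∫⁻ t in Set.Ioi (0 : ℝ), ENNReal.ofReal (a * t ^ (-(a : ℝ) - 1)) *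
        volume ({x : EuclideanSpace ℝ (Fin n) | ‖WithLp.toLp 2 fun i => s i * x i‖ < t} ∩
          ball 0 1) := by
  have : Nonempty (Fin n) := ⟨⟨a, han⟩⟩
  set N : EuclideanSpace ℝ (Fin n) → ℝ := fun x => ‖WithLp.toLp 2 fun i => s i * x i‖ with hN
  have hNm : Measurable N := by
    refine Continuous.measurable ?_
    fun_prop
  have hN0 : ∀ x, x ≠ 0 → 0 < N x := by
    intro x hx
    refine norm_pos_iff.2 fun h => hx ?_
    ext i
    have := congrArg (fun y : EuclideanSpace ℝ (Fin n) => y i) h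
    simpa [(hs i).ne'] using this
  have hNs : ∀ r : ℝ, 0 < r → ∀ x, N (r • x) = r * N x := by
    intro r hr x
    have : WithLp.toLp 2 (fun i => s i * (r • x) i) =
        r • (WithLp.toLp 2 fun i => s i * x i : EuclideanSpace ℝ (Fin n)) := by
      ext i
      simp only [PiLp.smul_apply, smul_eq_mul]
      ring
    rw [hN]
    simp only [this, norm_smul, Real.norm_of_nonneg hr.le]
  have hpolar := setLIntegral_ball_eq_toSphere
    (volume : Measure (EuclideanSpace ℝ (Fin n))) (a := a) (by simpa using han)
    (f := fun x => ENNReal.ofReal (N x ^ (-(a : ℝ)))) (by fun_prop) (fun r hr x => by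
      rw [hNs r hr, Real.mul_rpow hr.le (norm_nonneg _), ENNReal.ofReal_mul (by positivity)])
  rw [finrank_euclideanSpace_fin] at hpolar
  rw [← hpolar, lintegral_rpow_neg_eq_lintegral_meas_lt _ hNm _ (Nat.cast_pos.2 ha0)]
  · simp_rw [Measure.restrict_apply (measurableSet_lt hNm measurable_const)]
    rfl
  · refine ae_restrict_of_ae ?_
    filter_upwards [(measure_eq_zero_iff_ae_notMem.1
      (measure_singleton (μ := volume) (0 : EuclideanSpace ℝ (Fin n))))] with x hx
    exact hN0 x hx

/-- Integer case `0 < α < n` of the key integral estimate: for `A = diag(s₁,…,sₙ)` with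
`s₁ ≥ ⋯ ≥ sₙ > 0` and an integer `α = a`,
`∫_{S^{n-1}} |Ax|^{-α} dx ≈ (1 + log(s_α/s_{α+1}))/(s₁⋯s_α)`,
with constants depending only on `n` and `α`. -/
theorem integral_estimate_integer (n a : ℕ) (ha0 : 0 < a) (han : a < n) :
    ∃ c C : ℝ, 0 < c ∧ 0 < C ∧
      ∀ s : Fin n → ℝ, (∀ i, 0 < s i) → (∀ i j : Fin n, i ≤ j → s j ≤ s i) →
        c * (1 + Real.log (s ⟨a - 1, by omega⟩ / s ⟨a, han⟩)) /
            (∏ i ∈ Finset.univ.filter (fun i : Fin n => (i : ℕ) < a), s i) ≤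
          (∫ x : sphere (0 : EuclideanSpace ℝ (Fin n)) 1,
            ‖(EuclideanSpace.equiv (Fin n) ℝ).symm
              ((Matrix.diagonal s).mulVec (x : EuclideanSpace ℝ (Fin n)))‖ ^ (-(a : ℝ))
            ∂(volume : Measure (EuclideanSpace ℝ (Fin n))).toSphere) ∧
        (∫ x : sphere (0 : EuclideanSpace ℝ (Fin n)) 1,
            ‖(EuclideanSpace.equiv (Fin n) ℝ).symm
              ((Matrix.diagonal s).mulVec (x : EuclideanSpace ℝ (Fin n)))‖ ^ (-(a : ℝ))
            ∂(volume : Measure (EuclideanSpace ℝ (Fin n))).toSphere) ≤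
          C * (1 + Real.log (s ⟨a - 1, by omega⟩ / s ⟨a, han⟩)) /
            (∏ i ∈ Finset.univ.filter (fun i : Fin n => (i : ℕ) < a), s i) := by

  have hn : 0 < n := by omega
  have hna : (0 : ℝ) < n - a := sub_pos.2 (Nat.cast_lt.2 han)
  have ha' : (0 : ℝ) < a := Nat.cast_pos.2 ha0
  have hn' : (0 : ℝ) < n := Nat.cast_pos.2 hn
  refine ⟨(n - a) * (2 / n) ^ n, (n - a) * 2 ^ n * (2 * a), by positivity, by positivity, ?_⟩
  intro s hs hmono
  simp only [norm_diagonal_mulVec]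
  set S : Finset (Fin n) := Finset.univ.filter (fun i : Fin n => (i : ℕ) < a) with hS
  set p : ℝ := ∏ i ∈ S, s i with hp
  set b := s ⟨a, han⟩ with hb
  set c := s ⟨a - 1, by omega⟩ with hc
  set L := Real.log (c / b) with hL
  have hb0 : 0 < b := hs _
  have hc0 : 0 < c := hs _
  have hbc : b ≤ c := hmono _ _ (Fin.mk_le_mk.2 (Nat.sub_le a 1))
  have hp0 : 0 < p := Finset.prod_pos fun i _ => hs i
  have hL0 : 0 ≤ L := Real.log_nonneg ((one_le_div hb0).2 hbc)
  have hScard : #S = a := by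
    rw [hS, Fin.card_filter_val_lt, min_eq_right han.le]
  have haS : (⟨a, han⟩ : Fin n) ∉ S := by simp [hS]
  have hcS : (⟨a - 1, by omega⟩ : Fin n) ∈ S := by
    simp only [hS, Finset.mem_filter, Finset.mem_univ, true_and]
    omega
  have hkey := ofReal_mul_lintegral_toSphere_eq a ha0 han hs
  set N : EuclideanSpace ℝ (Fin n) → ℝ := fun x => ‖WithLp.toLp 2 fun i => s i * x i‖ with hN
  set I := ∫⁻ u : sphere (0 : EuclideanSpace ℝ (Fin n)) 1, ENNReal.ofReal (N u ^ (-(a : ℝ)))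
    ∂(volume : Measure (EuclideanSpace ℝ (Fin n))).toSphere with hI
  have hpull : ∀ k : ℝ, 0 ≤ k →
      ∫⁻ t in Set.Ioi (0 : ℝ), ENNReal.ofReal (a * t ^ (-(a : ℝ) - 1)) *
        ENNReal.ofReal (k * ∏ i, min 1 (t / s i)) =
      ENNReal.ofReal k * ∫⁻ t in Set.Ioi (0 : ℝ),
        ENNReal.ofReal (a * t ^ (-(a : ℝ) - 1) * ∏ i, min 1 (t / s i)) := by
    intro k hk
    rw [← lintegral_const_mul _ (by fun_prop)]
    refine setLIntegral_congr_fun measurableSet_Ioi fun t (ht : 0 < t) => ?_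
    rw [← ENNReal.ofReal_mul (by positivity), ← ENNReal.ofReal_mul hk]
    congr 1
    ring
  have hupper : ENNReal.ofReal (1 / (n - a)) * I ≤
      ENNReal.ofReal (2 ^ n * (a / p * (2 + L))) := by
    rw [hkey, ENNReal.ofReal_mul (by positivity)]
    calc _ ≤ ∫⁻ t in Set.Ioi (0 : ℝ), ENNReal.ofReal (a * t ^ (-(a : ℝ) - 1)) *
          ENNReal.ofReal (2 ^ n * ∏ i, min 1 (t / s i)) :=
          setLIntegral_mono' measurableSet_Ioi fun t ht =>
            mul_le_mul_right (volume_ball_inter_le hs ht) _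
      _ = _ := hpull _ (by positivity)
      _ ≤ _ := by
        refine mul_le_mul_right (lintegral_rpow_mul_le ha0 hb0 hbc hp0 ?_ ?_ ?_) _
        · intro t ht
          have := prod_min_one_div_le hs (insert ⟨a, han⟩ S) ht
          rwa [Finset.card_insert_of_notMem haS, Finset.prod_insert haS, hScard, mul_comm] at this
        · intro t ht
          have := prod_min_one_div_le hs S ht
          rwa [hScard] at this
        · intro t ht
          have := prod_min_one_div_le hs (S.erase ⟨a - 1, by omega⟩) ht
          rw [Finset.card_erase_of_mem hcS, hScard] at this
          rw [hp, ← Finset.mul_prod_erase S s hcS, mul_comm _ c, mul_div_mul_left _ _ hc0.ne']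
          exact this
  have hlower : ENNReal.ofReal ((2 / n) ^ n * (1 / p * (1 + L))) ≤
      ENNReal.ofReal (1 / (n - a)) * I := by
    rw [hkey, ENNReal.ofReal_mul (by positivity)]
    calc _ ≤ ENNReal.ofReal ((2 / n) ^ n) * ∫⁻ t in Set.Ioi (0 : ℝ),
          ENNReal.ofReal (a * t ^ (-(a : ℝ) - 1) * ∏ i, min 1 (t / s i)) := by
          refine mul_le_mul_right (le_lintegral_rpow_mul ha0 hb0 hbc hp0 fun t ht => ?_) _
          have := le_prod_min_one_div hs S (hb0.trans_le ht) hc0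
            (fun i hi => hmono _ _ ?_) (fun i hi => (hmono _ _ ?_).trans ht)
          · rwa [hScard] at this
          · simp only [hS, Finset.mem_filter, Finset.mem_univ, true_and] at hi
            exact Fin.le_def.2 (Nat.le_sub_one_of_lt hi)
          · simp only [hS, Finset.mem_filter, Finset.mem_univ, true_and, not_lt] at hi
            exact Fin.le_def.2 hi
      _ = _ := (hpull _ (by positivity)).symm
      _ ≤ _ := setLIntegral_mono' measurableSet_Ioi fun t ht =>
            mul_le_mul_right (le_volume_ball_inter hn hs ht) _
  have hint : ∫ u : sphere (0 : EuclideanSpace ℝ (Fin n)) 1, N u ^ (-(a : ℝ))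
      ∂(volume : Measure (EuclideanSpace ℝ (Fin n))).toSphere = I.toReal := by
    refine integral_eq_lintegral_of_nonneg_ae
      (.of_forall fun u => Real.rpow_nonneg (norm_nonneg _) _) ?_
    have : Continuous N := by fun_prop
    exact ((this.measurable.comp measurable_subtype_coe).pow_const _).aestronglyMeasurable
  have hItop : I ≠ ⊤ := by
    intro h
    rw [h, ENNReal.mul_top (by simpa using hna)] at hupper
    exact ENNReal.ofReal_ne_top (top_le_iff.1 hupper)
  rw [← ENNReal.ofReal_toReal hItop, ← ENNReal.ofReal_mul (by positivity),
    ENNReal.ofReal_le_ofReal_iff (by positivity), one_div_mul_eq_div (_ - _)] at hupper hlower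
  rw [div_le_iff₀ hna] at hupper
  rw [le_div_iff₀ hna] at hlower
  change _ ≤ ∫ u : sphere (0 : EuclideanSpace ℝ (Fin n)) 1, N u ^ (-(a : ℝ)) ∂_ ∧
    ∫ u : sphere (0 : EuclideanSpace ℝ (Fin n)) 1, N u ^ (-(a : ℝ)) ∂_ ≤ _
  rw [hint]
  constructor
  · refine le_trans (le_of_eq ?_) hlower
    ring
  · calc I.toReal ≤ 2 ^ n * (a / p * (2 + L)) * (n - a) := hupper
      _ ≤ 2 ^ n * (a / p * (2 * (1 + L))) * (n - a) := by
        gcongr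
        linarith
      _ = _ := by ring
end

section
/- Let m ≥ 2, let B = diag(s_1,…,s_m) with s_1 ≥ … ≥ s_m > 0, and let β ∈ (0, m-1]. Set l = 1 + ⌊β⌋ ≤ m and let B_l = diag(s_1,…,s_l). Then there exist constants c, C > 0 depending only on m and β such that c ∫_{S^{l-1}} |B_l y|^{-β} dy ≤ ∫_{S^{m-1}} |Bx|^{-β} dx ≤ C ∫_{S^{l-1}} |B_l y|^{-β} dy. -/
open MeasureTheory Metric Finset

open scoped ENNReal

theorem lintegral_ball_eq_lintegral_sphere_mul {E : Type*} [NormedAddCommGroup E] [NormedSpace ℝ E]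
    [MeasurableSpace E] [BorelSpace E] [FiniteDimensional ℝ E] [Nontrivial E]
    (μ : Measure E) [μ.IsAddHaarMeasure] {g : E → ℝ≥0∞} (hg : Measurable g) (a : ℝ)
    (hom : ∀ r : ℝ, 0 < r → ∀ x ∈ sphere (0 : E) 1, g (r • x) = ENNReal.ofReal (r ^ a) * g x)
    (R : ℝ) :
    ∫⁻ x in ball 0 R, g x ∂μ = (∫⁻ y : sphere (0 : E) 1, g y ∂μ.toSphere) *
      ∫⁻ r in Set.Ioo 0 R, ENNReal.ofReal (r ^ ((Module.finrank ℝ E : ℝ) - 1 + a)) := by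
  have hn : 0 < Module.finrank ℝ E := Module.finrank_pos
  set h : ℝ → ℝ≥0∞ := fun r ↦ (Set.Iio R).indicator (fun r ↦ ENNReal.ofReal (r ^ a)) r with hh
  have hhm : Measurable h := (by fun_prop : Measurable fun r : ℝ ↦ ENNReal.ofReal (r ^ a)).indicator
    measurableSet_Iio
  calc
    _ = ∫⁻ x, (ball (0 : E) R).indicator g x ∂μ := (lintegral_indicator measurableSet_ball _).symm
    _ = ∫⁻ x in ({0}ᶜ : Set E), (ball (0 : E) R).indicator g x ∂μ := by
      rw [restrict_compl_singleton]
    _ = ∫⁻ x : ({0}ᶜ : Set E), (ball (0 : E) R).indicator g x ∂(μ.comap (↑)) :=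
      (lintegral_subtype_comap (measurableSet_singleton _).compl _).symm
    _ = ∫⁻ x, (ball (0 : E) R).indicator g ((homeomorphUnitSphereProd E).symm x)
          ∂μ.toSphere.prod (.volumeIoiPow (Module.finrank ℝ E - 1)) := by
      rw [← μ.measurePreserving_homeomorphUnitSphereProd.lintegral_comp_emb
        (Homeomorph.measurableEmbedding _)]
      simp
    _ = ∫⁻ x : sphere (0 : E) 1 × Set.Ioi (0 : ℝ), g x.1 * h x.2
          ∂μ.toSphere.prod (.volumeIoiPow (Module.finrank ℝ E - 1)) := by
      refine lintegral_congr fun ⟨y, r⟩ ↦ ?_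
      have hr : 0 < (r : ℝ) := r.2
      have hy : ‖(y : E)‖ = 1 := by simp
      by_cases hrR : (r : ℝ) < R
      · simp [hh, hrR, norm_smul, abs_of_pos hr, hom r hr y y.2, mul_comm, Set.indicator]
      · simp [hh, hrR, norm_smul, abs_of_pos hr, Set.indicator]
    _ = (∫⁻ y : sphere (0 : E) 1, g y ∂μ.toSphere) *
        ∫⁻ r : Set.Ioi (0 : ℝ), h r ∂.volumeIoiPow (Module.finrank ℝ E - 1) :=
      lintegral_prod_mul (f := fun y : sphere (0 : E) 1 ↦ g y) (g := fun r : Set.Ioi (0 : ℝ) ↦ h r)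
        (hg.comp measurable_subtype_coe).aemeasurable
        (hhm.comp measurable_subtype_coe).aemeasurable
    _ = _ := by
      congr 1
      rw [Measure.volumeIoiPow, lintegral_withDensity_eq_lintegral_mul _
        (g := fun r : Set.Ioi (0 : ℝ) ↦ h r) (by fun_prop)
        (hhm.comp measurable_subtype_coe)]
      simp only [Pi.mul_apply]
      rw [lintegral_subtype_comap measurableSet_Ioi
        (fun r : ℝ ↦ ENNReal.ofReal (r ^ (Module.finrank ℝ E - 1)) * h r),
        ← lintegral_indicator measurableSet_Ioi, ← lintegral_indicator measurableSet_Ioo]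
      refine lintegral_congr fun r ↦ ?_
      by_cases hr : 0 < r <;> by_cases hrR : r < R <;> simp [Set.indicator, hh, hr, hrR]
      rw [← ENNReal.ofReal_mul (by positivity), Real.rpow_add hr, ← Nat.cast_pred hn,
        Real.rpow_natCast]

theorem lintegral_Ioo_rpow_ne_zero {R : ℝ} (hR : 0 < R) (a : ℝ) :
    ∫⁻ r in Set.Ioo 0 R, ENNReal.ofReal (r ^ a) ≠ 0 := by
  rw [← pos_iff_ne_zero, setLIntegral_pos_iff (by fun_prop)]
  have : Function.support (fun r : ℝ ↦ ENNReal.ofReal (r ^ a)) ∩ Set.Ioo 0 R = Set.Ioo 0 R := by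
    refine Set.inter_eq_right.2 fun r hr ↦ ?_
    simpa using Real.rpow_pos_of_pos hr.1 a
  simp [this, hR]

theorem lintegral_Ioo_rpow_ne_top {a : ℝ} (ha : -1 < a) (R : ℝ) :
    ∫⁻ r in Set.Ioo 0 R, ENNReal.ofReal (r ^ a) ≠ ∞ := by
  rcases le_or_gt R 0 with hR | hR
  · simp [Set.Ioo_eq_empty_of_le hR]
  · have := (intervalIntegral.integrableOn_Ioo_rpow_iff hR).2 ha
    have h2 := (hasFiniteIntegral_iff_ofReal ?_).1 this.2
    · exact h2.ne
    · filter_upwards [ae_restrict_mem measurableSet_Ioo] with r hr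
      exact Real.rpow_nonneg hr.1.le a

theorem ofReal_integral_sphere_norm_rpow {E F : Type*} [NormedAddCommGroup E] [NormedSpace ℝ E]
    [MeasurableSpace E] [BorelSpace E] [FiniteDimensional ℝ E]
    [NormedAddCommGroup F] [NormedSpace ℝ F]
    (μ : Measure E) [μ.IsAddHaarMeasure] (T : E →L[ℝ] F) (hT : Function.Injective T) (a : ℝ) :
    ENNReal.ofReal (∫ y : sphere (0 : E) 1, ‖T y‖ ^ a ∂μ.toSphere) =
      ∫⁻ y : sphere (0 : E) 1, ‖T y‖ₑ ^ a ∂μ.toSphere := by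
  have hpos (y : sphere (0 : E) 1) : 0 < ‖T y‖ := by
    rw [norm_pos_iff, Ne, map_eq_zero_iff T hT]
    exact ne_zero_of_mem_unit_sphere y
  have hc : Continuous fun y : sphere (0 : E) 1 ↦ ‖T y‖ ^ a :=
    Continuous.rpow_const (by fun_prop) fun y ↦ .inl (hpos y).ne'
  rw [ofReal_integral_eq_lintegral_ofReal
    (hc.integrable_of_hasCompactSupport (HasCompactSupport.of_compactSpace _))
    (.of_forall fun y ↦ by positivity)]
  refine lintegral_congr fun y ↦ ?_
  rw [← ENNReal.ofReal_rpow_of_pos (hpos y), ofReal_norm]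

theorem lintegral_ball_norm_pow_mul_norm_rpow {E F : Type*} [NormedAddCommGroup E] [NormedSpace ℝ E]
    [MeasurableSpace E] [BorelSpace E] [FiniteDimensional ℝ E] [Nontrivial E]
    [NormedAddCommGroup F] [NormedSpace ℝ F]
    (μ : Measure E) [μ.IsAddHaarMeasure] (T : E →L[ℝ] F) (d : ℕ) (a R : ℝ) :
    ∫⁻ x in ball 0 R, ‖x‖ₑ ^ d * ‖T x‖ₑ ^ a ∂μ =
      (∫⁻ y : sphere (0 : E) 1, ‖T y‖ₑ ^ a ∂μ.toSphere) *
      ∫⁻ r in Set.Ioo 0 R, ENNReal.ofReal (r ^ ((Module.finrank ℝ E : ℝ) - 1 + (d + a))) := by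
  borelize F
  rw [lintegral_ball_eq_lintegral_sphere_mul μ (g := fun x ↦ ‖x‖ₑ ^ d * ‖T x‖ₑ ^ a)
    (by fun_prop) (d + a)]
  · congr 1
    refine lintegral_congr fun y ↦ ?_
    simp [← ofReal_norm (y : E)]
  · intro r hr x hx
    rw [map_smul, enorm_smul, enorm_smul, ENNReal.mul_rpow_of_ne_top (by simp) (by simp), mul_pow,
      Real.rpow_add hr, ENNReal.ofReal_mul (by positivity), Real.rpow_natCast,
      ENNReal.ofReal_pow hr.le, ← ENNReal.ofReal_rpow_of_pos hr, Real.enorm_of_nonneg hr.le]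
    ring

section Fibred

variable {E U V F G : Type*} [NormedAddCommGroup E] [NormedSpace ℝ E]
  [MeasurableSpace E] [BorelSpace E]
  [NormedAddCommGroup U] [NormedSpace ℝ U]
  [MeasurableSpace U] [BorelSpace U] [FiniteDimensional ℝ U]
  [NormedAddCommGroup V] [NormedSpace ℝ V]
  [MeasurableSpace V] [FiniteDimensional ℝ V]
  [NormedAddCommGroup F] [NormedSpace ℝ F] [NormedAddCommGroup G] [NormedSpace ℝ G]
  {μ : Measure E} {ν : Measure U} {ρ : Measure V}
  [ρ.IsAddHaarMeasure]
  {e : U × V → E} {T : E →L[ℝ] F} {S : U →L[ℝ] G} {β : ℝ}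

theorem lintegral_ball_norm_rpow_neg_le [SFinite ν] (he : MeasurePreserving e (ν.prod ρ) μ)
    (hnorm : ∀ p, ‖e p‖ ^ 2 = ‖p.1‖ ^ 2 + ‖p.2‖ ^ 2) (hβ : 0 ≤ β)
    (hST : ∀ p, ‖S p.1‖ ≤ ‖T (e p)‖) :
    ∫⁻ x in ball 0 1, ‖T x‖ₑ ^ (-β) ∂μ ≤
      (∫⁻ u in ball 0 1, ‖S u‖ₑ ^ (-β) ∂ν) * ρ (ball 0 1) := by
  borelize F
  borelize G
  calc
    _ = ∫⁻ p in e ⁻¹' ball 0 1, ‖T (e p)‖ₑ ^ (-β) ∂ν.prod ρ :=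
      (he.setLIntegral_comp_preimage measurableSet_ball
        (f := fun x ↦ ‖T x‖ₑ ^ (-β)) (by fun_prop)).symm
    _ ≤ ∫⁻ p in ball 0 1 ×ˢ ball 0 1, ‖T (e p)‖ₑ ^ (-β) ∂ν.prod ρ := by
      refine lintegral_mono_set fun p hp ↦ ?_
      have h1 : ‖e p‖ < 1 := by simpa using hp
      have h2 := hnorm p
      simp only [Set.mem_prod, mem_ball_zero_iff]
      constructor <;> nlinarith [norm_nonneg p.1, norm_nonneg p.2, norm_nonneg (e p)]
    _ ≤ ∫⁻ p in ball 0 1 ×ˢ ball 0 1, ‖S p.1‖ₑ ^ (-β) * 1 ∂ν.prod ρ := by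
      refine lintegral_mono fun p ↦ ?_
      rw [mul_one, ENNReal.rpow_neg, ENNReal.rpow_neg, ENNReal.inv_le_inv]
      exact ENNReal.rpow_le_rpow (enorm_le_iff_norm_le.2 (hST p)) hβ
    _ = _ := by
      rw [← Measure.prod_restrict,
        lintegral_prod_mul (f := fun u ↦ ‖S u‖ₑ ^ (-β)) (g := fun _ ↦ 1) (by fun_prop) (by fun_prop)]
      simp

theorem lintegral_ball_norm_pow_mul_norm_rpow_neg_le [BorelSpace V] (he : MeasurePreserving e (ν.prod ρ) μ)
    (hnorm : ∀ p, ‖e p‖ ^ 2 = ‖p.1‖ ^ 2 + ‖p.2‖ ^ 2) (hβ : 0 ≤ β)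
    (hTS : ∀ p, ‖p.2‖ ≤ ‖p.1‖ → ‖T (e p)‖ ≤ 2 * ‖S p.1‖) :
    (∫⁻ u in ball 0 (1 / 2), ‖u‖ₑ ^ Module.finrank ℝ V * ‖S u‖ₑ ^ (-β) ∂ν) * ρ (ball 0 1) ≤
      2 ^ β * ∫⁻ x in ball 0 1, ‖T x‖ₑ ^ (-β) ∂μ := by
  borelize F
  borelize G
  set D : Set (U × V) := {p | ‖p.1‖ < 1 / 2 ∧ ‖p.2‖ ≤ ‖p.1‖} with hD
  have hDm : MeasurableSet D :=
    (measurableSet_lt (f := fun p : U × V ↦ ‖p.1‖) (by fun_prop) measurable_const).inter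
      (measurableSet_le (f := fun p : U × V ↦ ‖p.2‖) (g := fun p ↦ ‖p.1‖)
        (by fun_prop) (by fun_prop))
  calc
    _ = ∫⁻ u in ball 0 (1 / 2), ∫⁻ v in closedBall 0 ‖u‖, ‖S u‖ₑ ^ (-β) ∂ρ ∂ν := by
      rw [← lintegral_mul_const _ (by fun_prop)]
      refine lintegral_congr fun u ↦ ?_
      rw [setLIntegral_const, Measure.addHaar_closedBall _ _ (norm_nonneg u),
        ENNReal.ofReal_pow (norm_nonneg u), ofReal_norm]
      ring
    _ = ∫⁻ u, ∫⁻ v, D.indicator (fun p ↦ ‖S p.1‖ₑ ^ (-β)) (u, v) ∂ρ ∂ν := by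
      rw [← lintegral_indicator measurableSet_ball]
      refine lintegral_congr fun u ↦ ?_
      by_cases hu : ‖u‖ < 1 / 2
      · rw [Set.indicator_of_mem (by simpa using hu), ← lintegral_indicator measurableSet_closedBall]
        refine lintegral_congr fun v ↦ ?_
        have hu' : ‖u‖ < 2⁻¹ := by simpa using hu
        simp [hD, Set.indicator, hu']
      · have hu' : ¬ ‖u‖ < 2⁻¹ := by simpa using hu
        simp [hD, Set.indicator, hu']
    _ = ∫⁻ p in D, ‖S p.1‖ₑ ^ (-β) ∂ν.prod ρ := by
      rw [← lintegral_indicator hDm, lintegral_prod]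
      exact (Measurable.indicator (by fun_prop) hDm).aemeasurable
    _ ≤ ∫⁻ p in D, 2 ^ β * ‖T (e p)‖ₑ ^ (-β) ∂ν.prod ρ := by
      refine setLIntegral_mono' hDm fun p hp ↦ ?_
      have h1 : ‖T (e p)‖ₑ ≤ 2 * ‖S p.1‖ₑ := by
        have := ENNReal.ofReal_le_ofReal (hTS p hp.2)
        rwa [ENNReal.ofReal_mul zero_le_two, ofReal_norm, ofReal_norm, ENNReal.ofReal_ofNat] at this
      have h2 := ENNReal.rpow_le_rpow h1 hβ
      rw [ENNReal.mul_rpow_of_nonneg _ _ hβ] at h2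
      rw [ENNReal.rpow_neg, ENNReal.rpow_neg, ← div_eq_mul_inv]
      have h20 : (2 : ℝ≥0∞) ^ β ≠ 0 := by simp [ENNReal.rpow_eq_zero_iff]
      have h2t : (2 : ℝ≥0∞) ^ β ≠ ∞ := ENNReal.rpow_ne_top_of_nonneg hβ (by simp)
      calc (‖S p.1‖ₑ ^ β)⁻¹ = 2 ^ β * (2 ^ β * ‖S p.1‖ₑ ^ β)⁻¹ := by
            rw [ENNReal.mul_inv (.inl h20) (.inl h2t), ← mul_assoc,
              ENNReal.mul_inv_cancel h20 h2t, one_mul]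
        _ ≤ _ := by rw [div_eq_mul_inv]; gcongr
    _ ≤ ∫⁻ p in e ⁻¹' ball 0 1, 2 ^ β * ‖T (e p)‖ₑ ^ (-β) ∂ν.prod ρ := by
      refine lintegral_mono_set fun p hp ↦ ?_
      have h1 : ‖p.1‖ < 1 / 2 := hp.1
      have h2 : ‖p.2‖ ≤ ‖p.1‖ := hp.2
      have h3 := hnorm p
      simp only [Set.mem_preimage, mem_ball_zero_iff]
      nlinarith [norm_nonneg p.1, norm_nonneg p.2, norm_nonneg (e p)]
    _ = _ := by
      rw [he.setLIntegral_comp_preimage measurableSet_ball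
        (f := fun x ↦ 2 ^ β * ‖T x‖ₑ ^ (-β)) (by fun_prop), lintegral_const_mul _ (by fun_prop)]

end Fibred

open Module in
/-- The integrals over the unit spheres of `‖T x‖ ^ (-β)` and `‖S u‖ ^ (-β)` are comparable
when `T` dominates `S` and is controlled by `S` on a cone around the first factor, with constants
which do not depend on `S` and `T`. -/
theorem exists_integral_sphere_norm_rpow_neg_comparable
    {E U V F G : Type*} [NormedAddCommGroup E] [NormedSpace ℝ E]
    [MeasurableSpace E] [BorelSpace E] [FiniteDimensional ℝ E] [Nontrivial E]
    [NormedAddCommGroup U] [NormedSpace ℝ U]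
    [MeasurableSpace U] [BorelSpace U] [FiniteDimensional ℝ U] [Nontrivial U]
    [NormedAddCommGroup V] [NormedSpace ℝ V]
    [MeasurableSpace V] [BorelSpace V] [FiniteDimensional ℝ V]
    [NormedAddCommGroup F] [NormedSpace ℝ F] [NormedAddCommGroup G] [NormedSpace ℝ G]
    {μ : Measure E} {ν : Measure U} {ρ : Measure V}
    [μ.IsAddHaarMeasure] [ν.IsAddHaarMeasure] [ρ.IsAddHaarMeasure]
    {e : U × V → E} {β : ℝ} (he : MeasurePreserving e (ν.prod ρ) μ)
    (hnorm : ∀ p, ‖e p‖ ^ 2 = ‖p.1‖ ^ 2 + ‖p.2‖ ^ 2)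
    (hdim : finrank ℝ E = finrank ℝ U + finrank ℝ V) (hβ : 0 ≤ β) (hβU : β < finrank ℝ U) :
    ∃ c C : ℝ, 0 < c ∧ 0 < C ∧ ∀ (T : E →L[ℝ] F) (S : U →L[ℝ] G),
      Function.Injective T → Function.Injective S → (∀ p, ‖S p.1‖ ≤ ‖T (e p)‖) →
      (∀ p, ‖p.2‖ ≤ ‖p.1‖ → ‖T (e p)‖ ≤ 2 * ‖S p.1‖) →
      c * ∫ y : sphere (0 : U) 1, ‖S y‖ ^ (-β) ∂ν.toSphere ≤
          ∫ x : sphere (0 : E) 1, ‖T x‖ ^ (-β) ∂μ.toSphere ∧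
        ∫ x : sphere (0 : E) 1, ‖T x‖ ^ (-β) ∂μ.toSphere ≤
          C * ∫ y : sphere (0 : U) 1, ‖S y‖ ^ (-β) ∂ν.toSphere := by
  have key (a R : ℝ) (ha : -1 < a) (hR : 0 < R) : ∃ k : ℝ, 0 < k ∧
      ∫⁻ r in Set.Ioo 0 R, ENNReal.ofReal (r ^ a) = ENNReal.ofReal k :=
    ⟨_, ENNReal.toReal_pos (lintegral_Ioo_rpow_ne_zero hR a) (lintegral_Ioo_rpow_ne_top ha R),
      (ENNReal.ofReal_toReal (lintegral_Ioo_rpow_ne_top ha R)).symm⟩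
  have hdim' : (finrank ℝ E : ℝ) = finrank ℝ U + finrank ℝ V := by exact_mod_cast hdim
  have hV : (0 : ℝ) ≤ finrank ℝ V := by positivity
  obtain ⟨k₁, hk₁, h₁⟩ := key ((finrank ℝ E : ℝ) - 1 + ((0 : ℕ) + -β)) 1
    (by push_cast; linarith) one_pos
  obtain ⟨k₂, hk₂, h₂⟩ := key ((finrank ℝ U : ℝ) - 1 + ((0 : ℕ) + -β)) 1
    (by push_cast; linarith) one_pos
  obtain ⟨k₃, hk₃, h₃⟩ := key ((finrank ℝ U : ℝ) - 1 + (finrank ℝ V + -β)) (1 / 2)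
    (by linarith) (by norm_num)
  have hv : 0 < ρ.real (ball 0 1) :=
    ENNReal.toReal_pos (measure_ball_pos ρ 0 one_pos).ne' measure_ball_lt_top.ne
  have hvρ : ρ (ball 0 1) = ENNReal.ofReal (ρ.real (ball 0 1)) :=
    (ENNReal.ofReal_toReal measure_ball_lt_top.ne).symm
  set v := ρ.real (ball 0 1)
  refine ⟨k₃ * v / (2 ^ β * k₁), k₂ * v / k₁, by positivity, by positivity,
    fun T S hT hS hST hTS ↦ ?_⟩
  have upper := lintegral_ball_norm_rpow_neg_le he hnorm hβ hST
  have lower := lintegral_ball_norm_pow_mul_norm_rpow_neg_le he hnorm hβ hTS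
  have hE := lintegral_ball_norm_pow_mul_norm_rpow μ T 0 (-β) 1
  have hU := lintegral_ball_norm_pow_mul_norm_rpow ν S 0 (-β) 1
  simp only [pow_zero, one_mul] at hE hU
  rw [hE, hU, h₁, h₂, hvρ, ← ofReal_integral_sphere_norm_rpow μ T hT,
    ← ofReal_integral_sphere_norm_rpow ν S hS] at upper
  rw [hE, lintegral_ball_norm_pow_mul_norm_rpow, h₁, h₃, hvρ,
    ← ofReal_integral_sphere_norm_rpow μ T hT, ← ofReal_integral_sphere_norm_rpow ν S hS,
    ← ENNReal.ofReal_ofNat 2, ENNReal.ofReal_rpow_of_pos two_pos] at lower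
  have hT0 : 0 ≤ ∫ x : sphere (0 : E) 1, ‖T x‖ ^ (-β) ∂μ.toSphere :=
    integral_nonneg fun _ ↦ by positivity
  have hS0 : 0 ≤ ∫ y : sphere (0 : U) 1, ‖S y‖ ^ (-β) ∂ν.toSphere :=
    integral_nonneg fun _ ↦ by positivity
  set I := ∫ x : sphere (0 : E) 1, ‖T x‖ ^ (-β) ∂μ.toSphere
  set J := ∫ y : sphere (0 : U) 1, ‖S y‖ ^ (-β) ∂ν.toSphere
  rw [← ENNReal.ofReal_mul (by positivity), ← ENNReal.ofReal_mul (by positivity),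
    ← ENNReal.ofReal_mul (by positivity), ENNReal.ofReal_le_ofReal_iff (by positivity)] at upper
  rw [← ENNReal.ofReal_mul (by positivity), ← ENNReal.ofReal_mul (by positivity),
    ← ENNReal.ofReal_mul (by positivity), ← ENNReal.ofReal_mul (by positivity),
    ENNReal.ofReal_le_ofReal_iff (by positivity)] at lower
  constructor
  · rw [div_mul_eq_mul_div, div_le_iff₀ (by positivity)]
    linarith
  · rw [div_mul_eq_mul_div, le_div_iff₀ hk₁]
    linarith


/-- The linear operator on Euclidean space given by a diagonal matrix. -/
noncomputable def diagonalCLM {n : ℕ} (s : Fin n → ℝ) :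
    EuclideanSpace ℝ (Fin n) →L[ℝ] EuclideanSpace ℝ (Fin n) :=
  (Matrix.toEuclideanLin (Matrix.diagonal s)).toContinuousLinearMap

theorem diagonalCLM_apply {n : ℕ} (s : Fin n → ℝ) (x : EuclideanSpace ℝ (Fin n)) (i : Fin n) :
    diagonalCLM s x i = s i * x i := by
  simp [diagonalCLM, Matrix.toLpLin_apply, Matrix.mulVec_diagonal]

theorem norm_diagonalCLM_sq {n : ℕ} (s : Fin n → ℝ) (x : EuclideanSpace ℝ (Fin n)) :
    ‖diagonalCLM s x‖ ^ 2 = ∑ i, (s i * x i) ^ 2 := by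
  simp [EuclideanSpace.real_norm_sq_eq, diagonalCLM_apply]

theorem diagonalCLM_injective {n : ℕ} {s : Fin n → ℝ} (hs : ∀ i, s i ≠ 0) :
    Function.Injective (diagonalCLM s) := by
  intro x y hxy
  ext i
  have := congrArg (· i) hxy
  simpa [diagonalCLM_apply, hs i] using this

/-- Concatenation of vectors, from the product of two Euclidean spaces to Euclidean space. -/
noncomputable def euclideanAppend {l p : ℕ}
    (q : EuclideanSpace ℝ (Fin l) × EuclideanSpace ℝ (Fin p)) : EuclideanSpace ℝ (Fin (l + p)) :=
  WithLp.toLp 2 (Fin.append q.1 q.2)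

theorem norm_euclideanAppend_sq {l p : ℕ}
    (q : EuclideanSpace ℝ (Fin l) × EuclideanSpace ℝ (Fin p)) :
    ‖euclideanAppend q‖ ^ 2 = ‖q.1‖ ^ 2 + ‖q.2‖ ^ 2 := by
  simp [EuclideanSpace.norm_sq_eq, Fin.sum_univ_add, euclideanAppend]

theorem measurePreserving_euclideanAppend (l p : ℕ) :
    MeasurePreserving (euclideanAppend (l := l) (p := p)) (volume.prod volume) volume := by
  let f := ((PiLp.sumPiLpEquivProdLpPiLp (𝕜 := ℝ) (ι := Fin l) (κ := Fin p) 2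
    (fun _ ↦ ℝ)).symm.trans (LinearIsometryEquiv.piLpCongrLeft 2 ℝ ℝ
      finSumFinEquiv))
  have hf : euclideanAppend = f ∘ WithLp.toLp 2 := by
    ext q i
    refine Fin.addCases (fun i ↦ ?_) (fun i ↦ ?_) i <;>
      simp [f, euclideanAppend, LinearIsometryEquiv.piLpCongrLeft_apply]
  rw [hf]
  exact f.measurePreserving.comp (WithLp.volume_preserving_toLp _ _)

/-- **Dimension-reducing formula.** For `m ≥ 2`, `B = diag(s₁,…,s_m)` with
`s₁ ≥ ⋯ ≥ s_m > 0` and `β ∈ (0, m-1]`, with `l = 1 + ⌊β⌋` and `B_l = diag(s₁,…,s_l)`,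
the integral `∫_{S^{m-1}} |Bx|^{-β} dx` is comparable to `∫_{S^{l-1}} |B_l y|^{-β} dy`,
with constants depending only on `m` and `β`. -/
theorem dimension_reducing_formula (m : ℕ) (hm : 2 ≤ m) (β : ℝ) (hβ0 : 0 < β)
    (hβ1 : β ≤ (m : ℝ) - 1) (l : ℕ) (hl : l = 1 + ⌊β⌋₊) (hlm : l ≤ m) :
    ∃ c C : ℝ, 0 < c ∧ 0 < C ∧
      ∀ s : Fin m → ℝ, (∀ i, 0 < s i) → (∀ i j : Fin m, i ≤ j → s j ≤ s i) →
        c * (∫ y : sphere (0 : EuclideanSpace ℝ (Fin l)) 1,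
              ‖(EuclideanSpace.equiv (Fin l) ℝ).symm
                ((Matrix.diagonal (fun i : Fin l => s (Fin.castLE hlm i))).mulVec
                  (y : EuclideanSpace ℝ (Fin l)))‖ ^ (-β)
              ∂(volume : Measure (EuclideanSpace ℝ (Fin l))).toSphere) ≤
          (∫ x : sphere (0 : EuclideanSpace ℝ (Fin m)) 1,
              ‖(EuclideanSpace.equiv (Fin m) ℝ).symm
                ((Matrix.diagonal s).mulVec (x : EuclideanSpace ℝ (Fin m)))‖ ^ (-β)
              ∂(volume : Measure (EuclideanSpace ℝ (Fin m))).toSphere) ∧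
        (∫ x : sphere (0 : EuclideanSpace ℝ (Fin m)) 1,
              ‖(EuclideanSpace.equiv (Fin m) ℝ).symm
                ((Matrix.diagonal s).mulVec (x : EuclideanSpace ℝ (Fin m)))‖ ^ (-β)
              ∂(volume : Measure (EuclideanSpace ℝ (Fin m))).toSphere) ≤
          C * (∫ y : sphere (0 : EuclideanSpace ℝ (Fin l)) 1,
              ‖(EuclideanSpace.equiv (Fin l) ℝ).symm
                ((Matrix.diagonal (fun i : Fin l => s (Fin.castLE hlm i))).mulVec
                  (y : EuclideanSpace ℝ (Fin l)))‖ ^ (-β)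
              ∂(volume : Measure (EuclideanSpace ℝ (Fin l))).toSphere) := by
  obtain ⟨p, rfl⟩ := Nat.exists_eq_add_of_le hlm
  have : Nontrivial (EuclideanSpace ℝ (Fin l)) :=
    Module.nontrivial_of_finrank_pos (R := ℝ) (by simp; omega)
  have : Nontrivial (EuclideanSpace ℝ (Fin (l + p))) :=
    Module.nontrivial_of_finrank_pos (R := ℝ) (by simp; omega)
  have hβl : β < l := by
    rw [hl, add_comm]
    exact_mod_cast Nat.lt_floor_add_one β
  obtain ⟨c, C, hc, hC, h⟩ := exists_integral_sphere_norm_rpow_neg_comparable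
    (F := EuclideanSpace ℝ (Fin (l + p))) (G := EuclideanSpace ℝ (Fin l))
    (measurePreserving_euclideanAppend l p) norm_euclideanAppend_sq (by simp) hβ0.le (by simpa)
  refine ⟨c, C, hc, hC, fun s hs hanti ↦ ?_⟩
  have hsum (u : EuclideanSpace ℝ (Fin l)) (v : EuclideanSpace ℝ (Fin p)) :
      ‖diagonalCLM s (euclideanAppend (u, v))‖ ^ 2 =
        ‖diagonalCLM (fun i : Fin l ↦ s (Fin.castLE hlm i)) u‖ ^ 2 +
          ∑ j, (s (Fin.natAdd l j) * v j) ^ 2 := by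
    rw [norm_diagonalCLM_sq, norm_diagonalCLM_sq, Fin.sum_univ_add]
    simp [euclideanAppend, Fin.castAdd]
  refine h (diagonalCLM s) (diagonalCLM fun i : Fin l ↦ s (Fin.castLE hlm i))
    (diagonalCLM_injective fun i ↦ (hs i).ne') (diagonalCLM_injective fun i ↦ (hs _).ne')
    (fun ⟨u, v⟩ ↦ ?_) fun ⟨u, v⟩ huv ↦ ?_
  · refine abs_le_of_sq_le_sq' ?_ (norm_nonneg _) |>.2
    rw [hsum]
    exact le_add_of_nonneg_right (sum_nonneg fun j _ ↦ sq_nonneg _)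
  · refine abs_le_of_sq_le_sq' ?_ (by positivity) |>.2
    let k : Fin l := ⟨l - 1, by omega⟩
    let t := s (Fin.castLE hlm k)
    have ht : 0 < t := hs _
    have hv : ∑ j, (s (Fin.natAdd l j) * v j) ^ 2 ≤ t ^ 2 * ‖v‖ ^ 2 := by
      simp only [EuclideanSpace.norm_sq_eq, Real.norm_eq_abs, sq_abs, mul_sum, mul_pow]
      gcongr with j
      · exact (hs _).le
      · exact hanti _ _ (Fin.le_def.2 (by simp [k]; omega))
    have hu : t ^ 2 * ‖u‖ ^ 2 ≤ ‖diagonalCLM (fun i : Fin l ↦ s (Fin.castLE hlm i)) u‖ ^ 2 := by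
      rw [norm_diagonalCLM_sq]
      simp only [EuclideanSpace.norm_sq_eq, Real.norm_eq_abs, sq_abs, mul_sum, mul_pow]
      gcongr with j
      exact hanti _ _ (Fin.le_def.2 (by simp [k]; omega))
    have huv' : t ^ 2 * ‖v‖ ^ 2 ≤ t ^ 2 * ‖u‖ ^ 2 := by gcongr
    rw [hsum, mul_pow]
    linarith [sq_nonneg ‖diagonalCLM (fun i : Fin l ↦ s (Fin.castLE hlm i)) u‖]
end

section
/- Let Q be a star body in ℝ^n and let K be an origin-symmetric convex body in ℝ^n. Define the dual mixed entropy Ẽ(K,Q) = (1/n)∫_{S^{n-1}} log(ρ_K(u)/ρ_Q(u)) ρ_Q(u)^n du. Then Ẽ(K,Q) ≤ vol(Q)·log(min_{S^{n-1}} ρ_K) + C_Q, where C_Q is a constant depending only on n and Q, and vol(Q) = (1/n)∫_{S^{n-1}} ρ_Q^n du. -/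
open Metric MeasureTheory

/-- The radial function `ρ_K(u) = max{λ > 0 : λu ∈ K}`. -/
noncomputable def radFn {n : ℕ} (K : Set (EuclideanSpace ℝ (Fin n)))
    (u : EuclideanSpace ℝ (Fin n)) : ℝ :=
  sSup {r : ℝ | 0 < r ∧ r • u ∈ K}

open scoped ENNReal RealInnerProductSpace

/-- `-log |t|`, truncated below at `0` and equal to `∞` at `t = 0`. -/
noncomputable def negLogAbs (t : ℝ) : ℝ≥0∞ :=
  if t = 0 then ∞ else ENNReal.ofReal (-Real.log t)

theorem measurable_negLogAbs : Measurable negLogAbs :=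
  Measurable.ite (measurableSet_singleton 0) measurable_const
    Real.measurable_log.neg.ennreal_ofReal

theorem negLogAbs_le_of_abs_le {s t : ℝ} (h : |s| ≤ |t|) : negLogAbs t ≤ negLogAbs s := by
  unfold negLogAbs
  split_ifs with ht hs hs
  · exact le_rfl
  · simp_all
  · exact le_top
  · rw [← Real.log_abs s, ← Real.log_abs t]
    gcongr

theorem lintegral_negLogAbs_Icc_lt_top (a b : ℝ) (hab : a ≤ b) :
    ∫⁻ t in Set.Icc a b, negLogAbs t < ∞ := by
  have hIntegrable : IntegrableOn (fun t => -Real.log t) (Set.Icc a b) volume := by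
    rw [← intervalIntegrable_iff_integrableOn_Icc_of_le hab]
    exact intervalIntegral.intervalIntegrable_log'.neg
  refine lt_of_eq_of_lt (lintegral_congr_ae ?_) hIntegrable.lintegral_lt_top
  filter_upwards [ae_restrict_of_ae (Measure.ae_ne volume (0 : ℝ))] with t ht
  simp [negLogAbs, ht]

theorem lintegral_ball_negLogAbs_coord_lt_top {ι : Type*} [Fintype ι] (i : ι) :
    ∫⁻ x in ball (0 : EuclideanSpace ℝ ι) 1, negLogAbs (x i) < ∞ := by
  classical
  let S : ι → Set ℝ := fun _ => Set.Icc (-1) 1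
  have hmeas : Measurable fun y : ι → ℝ => negLogAbs (y i) :=
    measurable_negLogAbs.comp (measurable_pi_apply i)
  calc ∫⁻ x in ball (0 : EuclideanSpace ℝ ι) 1, negLogAbs (x i)
      ≤ ∫⁻ x in (WithLp.ofLp : EuclideanSpace ℝ ι → ι → ℝ) ⁻¹' Set.univ.pi S,
          negLogAbs (WithLp.ofLp x i) := by
        refine lintegral_mono_set fun x hx j _ => ?_
        rw [mem_ball_zero_iff] at hx
        exact abs_le.1 (((Real.norm_eq_abs _).symm.le.trans (PiLp.norm_apply_le x j)).trans hx.le)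
    _ = ∫⁻ y in Set.univ.pi S, negLogAbs (y i) :=
        (PiLp.volume_preserving_ofLp ι).setLIntegral_comp_preimage
          (MeasurableSet.univ_pi fun _ => measurableSet_Icc) hmeas
    _ = ∫⁻ t, negLogAbs t ∂((Measure.pi fun j => volume.restrict (S j)).map (Function.eval i)) := by
        rw [lintegral_map measurable_negLogAbs (measurable_pi_apply i), volume_pi,
          Measure.restrict_pi_pi]
    _ < ∞ := by
        rw [Measure.pi_map_eval, lintegral_smul_measure, smul_eq_mul]
        refine ENNReal.mul_lt_top (ENNReal.prod_lt_top fun j _ => ?_)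
          (lintegral_negLogAbs_Icc_lt_top _ _ (by norm_num))
        simp [S]

theorem lintegral_ball_negLogAbs_inner_eq {E : Type*} [NormedAddCommGroup E]
    [InnerProductSpace ℝ E] [FiniteDimensional ℝ E] [MeasurableSpace E] [BorelSpace E]
    {v w : E} (h : ‖v‖ = ‖w‖) :
    ∫⁻ x in ball (0 : E) 1, negLogAbs ⟪x, v⟫ = ∫⁻ x in ball (0 : E) 1, negLogAbs ⟪x, w⟫ := by
  let R : E ≃ₗᵢ[ℝ] E := (ℝ ∙ (v - w))ᗮ.reflection
  have hR : R v = w := Submodule.reflection_sub h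
  have hball : R ⁻¹' ball (0 : E) 1 = ball 0 1 := by
    ext x
    simp
  have hmeas : Measurable fun x : E => negLogAbs ⟪x, w⟫ :=
    measurable_negLogAbs.comp (measurable_id.inner measurable_const)
  rw [← R.measurePreserving.setLIntegral_comp_preimage measurableSet_ball hmeas, hball, ← hR]
  simp

theorem lintegral_toSphere_negLogAbs_inner_le {E : Type*} [NormedAddCommGroup E]
    [InnerProductSpace ℝ E] [FiniteDimensional ℝ E] [MeasurableSpace E] [BorelSpace E] (v : E) :
    (∫⁻ u : sphere (0 : E) 1, negLogAbs ⟪(u : E), v⟫ ∂(volume : Measure E).toSphere) *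
        Measure.volumeIoiPow (Module.finrank ℝ E - 1) (Set.Iio ⟨1, Set.mem_Ioi.2 one_pos⟩) ≤
      ∫⁻ x in ball (0 : E) 1, negLogAbs ⟪x, v⟫ := by
  set ν := Measure.volumeIoiPow (Module.finrank ℝ E - 1)
  let G : E → ℝ≥0∞ := (ball (0 : E) 1).indicator fun x => negLogAbs ⟪x, v⟫
  have hG : Measurable G :=
    (measurable_negLogAbs.comp (measurable_id.inner measurable_const)).indicator measurableSet_ball
  have hmp := (volume : Measure E).measurePreserving_homeomorphUnitSphereProd
  let P : sphere (0 : E) 1 × Set.Ioi (0 : ℝ) → ℝ≥0∞ := fun p => G ((p.2 : ℝ) • (p.1 : E))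
  have hP : Measurable P := hG.comp (by fun_prop)
  calc (∫⁻ u : sphere (0 : E) 1, negLogAbs ⟪(u : E), v⟫ ∂(volume : Measure E).toSphere) *
        ν (Set.Iio ⟨1, Set.mem_Ioi.2 one_pos⟩)
      ≤ ∫⁻ u : sphere (0 : E) 1, negLogAbs ⟪(u : E), v⟫ * ν (Set.Iio ⟨1, Set.mem_Ioi.2 one_pos⟩)
          ∂(volume : Measure E).toSphere := lintegral_mul_const_le _ _
    _ ≤ ∫⁻ u : sphere (0 : E) 1, ∫⁻ r, P (u, r) ∂ν ∂(volume : Measure E).toSphere := by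
        refine lintegral_mono fun u => ?_
        rw [← setLIntegral_const, ← lintegral_indicator measurableSet_Iio]
        refine lintegral_mono (Set.indicator_le fun r hr => ?_)
        have hr0 : (0 : ℝ) < r := r.2
        have hr1 : (r : ℝ) < 1 := hr
        have hmem : (r : ℝ) • (u : E) ∈ ball (0 : E) 1 := by
          simpa [norm_smul, abs_of_pos hr0] using hr1
        simp only [P, G, Set.indicator_of_mem hmem]
        refine negLogAbs_le_of_abs_le ?_
        rw [real_inner_smul_left, abs_mul, abs_of_pos hr0]
        exact mul_le_of_le_one_left (abs_nonneg _) hr1.le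
    _ = ∫⁻ p, P p ∂((volume : Measure E).toSphere.prod ν) := (lintegral_prod _ hP.aemeasurable).symm
    _ = ∫⁻ x : ({0}ᶜ : Set E), P (homeomorphUnitSphereProd E x)
          ∂(volume : Measure E).comap Subtype.val := (hmp.lintegral_comp hP).symm
    _ = ∫⁻ x : ({0}ᶜ : Set E), G x ∂(volume : Measure E).comap Subtype.val := by
        refine lintegral_congr fun x => ?_
        have hx : ‖(x : E)‖ ≠ 0 := norm_ne_zero_iff.2 x.2
        simp [P, smul_smul, hx]
    _ = ∫⁻ x in ({0}ᶜ : Set E), G x :=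
        lintegral_subtype_comap (measurableSet_singleton _).compl _
    _ ≤ ∫⁻ x, G x := setLIntegral_le_lintegral _ _
    _ = ∫⁻ x in ball (0 : E) 1, negLogAbs ⟪x, v⟫ := lintegral_indicator measurableSet_ball _

/-- The integrals of `-log |⟨u, v⟩|` over the unit sphere are bounded uniformly in `v`. -/
theorem exists_lintegral_toSphere_negLogAbs_inner_le {ι : Type*} [Fintype ι] [Nonempty ι] :
    ∃ D : ℝ≥0∞, D ≠ ∞ ∧ ∀ v : EuclideanSpace ℝ ι, ‖v‖ = 1 →
      ∫⁻ u : sphere (0 : EuclideanSpace ℝ ι) 1, negLogAbs ⟪(u : EuclideanSpace ℝ ι), v⟫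
        ∂(volume : Measure (EuclideanSpace ℝ ι)).toSphere ≤ D := by
  classical
  obtain ⟨i⟩ := ‹Nonempty ι›
  set c := Measure.volumeIoiPow (Module.finrank ℝ (EuclideanSpace ℝ ι) - 1)
    (Set.Iio ⟨1, Set.mem_Ioi.2 one_pos⟩) with hc
  have hc0 : c ≠ 0 := by
    rw [hc, Measure.volumeIoiPow_apply_Iio]
    simp only [one_pow, ne_eq, ENNReal.ofReal_eq_zero, not_le]
    positivity
  have hctop : c ≠ ∞ := by
    rw [hc, Measure.volumeIoiPow_apply_Iio]
    exact ENNReal.ofReal_ne_top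
  refine ⟨(∫⁻ x in ball (0 : EuclideanSpace ℝ ι) 1, negLogAbs (x i)) / c,
    ENNReal.div_ne_top (lintegral_ball_negLogAbs_coord_lt_top i).ne hc0, fun v hv => ?_⟩
  rw [ENNReal.le_div_iff_mul_le (.inl hc0) (.inl hctop)]
  refine (lintegral_toSphere_negLogAbs_inner_le v).trans_eq ?_
  rw [lintegral_ball_negLogAbs_inner_eq (w := EuclideanSpace.single i (1 : ℝ)) (by simp [hv])]
  simp [EuclideanSpace.inner_single_right]

theorem radFn_eq_inv_gauge {n : ℕ} {K : Set (EuclideanSpace ℝ (Fin n))} (hKc : Convex ℝ K)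
    (hKk : IsCompact K) (hK0 : (0 : EuclideanSpace ℝ (Fin n)) ∈ interior K)
    {u : EuclideanSpace ℝ (Fin n)} (hu : u ≠ 0) : radFn K u = (gauge K u)⁻¹ := by
  have hK : K ∈ nhds (0 : EuclideanSpace ℝ (Fin n)) := mem_interior_iff_mem_nhds.1 hK0
  have hpos : 0 < gauge K u :=
    (gauge_pos (absorbent_nhds_zero hK) (NormedSpace.isVonNBounded_of_isBounded ℝ hKk.isBounded)).2 hu
  have hmem : ∀ r : ℝ, 0 < r → (r • u ∈ K ↔ r ≤ (gauge K u)⁻¹) := fun r hr => by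
    rw [← hKk.isClosed.closure_eq, ← gauge_le_one_iff_mem_closure hKc hK,
      gauge_smul_of_nonneg hr.le, smul_eq_mul, hKk.isClosed.closure_eq, ← one_div,
      le_div_iff₀ hpos]
  have hset : {r : ℝ | 0 < r ∧ r • u ∈ K} = Set.Ioc 0 (gauge K u)⁻¹ := by
    ext r
    exact and_congr_right (hmem r)
  rw [radFn, hset, csSup_Ioc (inv_pos.2 hpos)]

/-- A convex body whose gauge is at most `M ‖·‖`, with equality at the unit vector `v`, lies in
the half-space `M ⟨·, v⟩ ≤ 1`. -/
theorem mul_inner_le_gauge {E : Type*} [NormedAddCommGroup E] [InnerProductSpace ℝ E] {K : Set E}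
    (hKc : Convex ℝ K) (hK : K ∈ nhds (0 : E)) {M : ℝ} (hM : ∀ x, gauge K x ≤ M * ‖x‖) {v : E}
    (hv : ‖v‖ = 1) (hvM : gauge K v = M) (u : E) : M * ⟪u, v⟫ ≤ gauge K u := by
  have hM0 : 0 ≤ M := hvM ▸ gauge_nonneg v
  have key : ∀ t : ℝ, 0 < t → M * (t - ‖t • v - u‖) ≤ gauge K u := fun t ht => by
    have h1 := gauge_add_le hKc (absorbent_nhds_zero hK) u (t • v - u)
    rw [add_sub_cancel, gauge_smul_of_nonneg ht.le, hvM, smul_eq_mul] at h1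
    linarith [hM (t • v - u)]
  have hnorm : ∀ t : ℝ, 0 < t → ‖t • v - u‖ ≤ t - ⟪u, v⟫ + ‖u‖ ^ 2 / (2 * t) := fun t ht => by
    have hsq : ‖t • v - u‖ ^ 2 = t ^ 2 - 2 * (t * ⟪u, v⟫) + ‖u‖ ^ 2 := by
      rw [norm_sub_sq_real, norm_smul, real_inner_smul_left, real_inner_comm, hv, Real.norm_eq_abs,
        mul_one, sq_abs]
    have h2 : ‖t • v - u‖ ≤ (‖t • v - u‖ ^ 2 + t ^ 2) / (2 * t) := by
      rw [le_div_iff₀ (by positivity)]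
      nlinarith [sq_nonneg (‖t • v - u‖ - t)]
    refine h2.trans_eq ?_
    rw [hsq]
    field_simp
    ring
  have hlim : Filter.Tendsto (fun t : ℝ => M * (⟪u, v⟫ - ‖u‖ ^ 2 / (2 * t))) Filter.atTop
      (nhds (M * (⟪u, v⟫ - 0))) :=
    (tendsto_const_nhds.sub (Filter.Tendsto.const_div_atTop
      (Filter.tendsto_id.const_mul_atTop two_pos) _)).const_mul M
  rw [sub_zero] at hlim
  refine le_of_tendsto hlim ?_
  filter_upwards [Filter.eventually_gt_atTop 0] with t ht
  exact (mul_le_mul_of_nonneg_left (by linarith [hnorm t ht]) hM0).trans (key t ht)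

/-- Entropy bound (Lemma 6.1): for a star body `Q` and any origin-symmetric convex body `K`,
`Ẽ(K,Q) ≤ vol(Q)·log(min ρ_K) + C_Q` with `C_Q` depending only on `n` and `Q`, where
`Ẽ(K,Q) = (1/n)∫ log(ρ_K/ρ_Q) ρ_Q^n du` and `vol(Q) = (1/n)∫ ρ_Q^n du`. -/
theorem dual_mixed_entropy_bound (n : ℕ) (hn : 2 ≤ n)
    (ρQ : EuclideanSpace ℝ (Fin n) → ℝ) (hρQc : ContinuousOn ρQ (sphere 0 1))
    (hρQpos : ∀ u ∈ sphere (0 : EuclideanSpace ℝ (Fin n)) 1, 0 < ρQ u)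
    (hρQe : ∀ u ∈ sphere (0 : EuclideanSpace ℝ (Fin n)) 1, ρQ (-u) = ρQ u) :
    ∃ C : ℝ,
      ∀ K : Set (EuclideanSpace ℝ (Fin n)), Convex ℝ K → IsCompact K →
        (0 : EuclideanSpace ℝ (Fin n)) ∈ interior K → K = -K →
        ((1 : ℝ) / n) * (∫ u : sphere (0 : EuclideanSpace ℝ (Fin n)) 1,
            Real.log (radFn K (u : EuclideanSpace ℝ (Fin n)) /
                ρQ (u : EuclideanSpace ℝ (Fin n))) *
              ρQ (u : EuclideanSpace ℝ (Fin n)) ^ (n : ℕ)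
            ∂(volume : Measure (EuclideanSpace ℝ (Fin n))).toSphere) ≤
          (((1 : ℝ) / n) * (∫ u : sphere (0 : EuclideanSpace ℝ (Fin n)) 1,
              ρQ (u : EuclideanSpace ℝ (Fin n)) ^ (n : ℕ)
              ∂(volume : Measure (EuclideanSpace ℝ (Fin n))).toSphere)) *
            Real.log (sInf (radFn K '' sphere (0 : EuclideanSpace ℝ (Fin n)) 1)) + C := by

  have : NeZero n := ⟨by omega⟩
  set σ := (volume : Measure (EuclideanSpace ℝ (Fin n))).toSphere
  obtain ⟨D, hDtop, hD⟩ := exists_lintegral_toSphere_negLogAbs_inner_le (ι := Fin n)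
  obtain ⟨B, hB⟩ := (isCompact_sphere (0 : EuclideanSpace ℝ (Fin n)) 1).exists_bound_of_continuousOn
    (hρQc.pow n)
  have hρQc' : Continuous fun u : sphere (0 : EuclideanSpace ℝ (Fin n)) 1 => ρQ u :=
    continuousOn_iff_continuous_domRestrict.1 hρQc
  have hIntegrable : ∀ f : sphere (0 : EuclideanSpace ℝ (Fin n)) 1 → ℝ, Continuous f → Integrable f σ :=
    fun f hf => hf.integrable_of_hasCompactSupport (HasCompactSupport.of_compactSpace f)
  refine ⟨(1 : ℝ) / n * ((ENNReal.ofReal B * D).toReal -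
    ∫ u : sphere (0 : EuclideanSpace ℝ (Fin n)) 1, Real.log (ρQ u) * ρQ u ^ n ∂σ),
    fun K hKc hKk hK0 hKs => ?_⟩
  have hK : K ∈ nhds (0 : EuclideanSpace ℝ (Fin n)) := mem_interior_iff_mem_nhds.1 hK0
  have hsymm : ∀ x ∈ K, -x ∈ K := fun x hx => by rwa [hKs, Set.mem_neg, neg_neg]
  have hne : ∀ u ∈ sphere (0 : EuclideanSpace ℝ (Fin n)) 1, u ≠ 0 :=
    fun u hu => ne_zero_of_mem_unit_sphere ⟨u, hu⟩
  have hgpos : ∀ u ∈ sphere (0 : EuclideanSpace ℝ (Fin n)) 1, 0 < gauge K u := fun u hu =>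
    (gauge_pos (absorbent_nhds_zero hK)
      (NormedSpace.isVonNBounded_of_isBounded ℝ hKk.isBounded)).2 (hne u hu)
  have hrad : ∀ u ∈ sphere (0 : EuclideanSpace ℝ (Fin n)) 1, radFn K u = (gauge K u)⁻¹ :=
    fun u hu => radFn_eq_inv_gauge hKc hKk hK0 (hne u hu)
  have hgc : Continuous (gauge K) := continuous_gauge hKc hK
  obtain ⟨v, hv, hvmax⟩ := (isCompact_sphere (0 : EuclideanSpace ℝ (Fin n)) 1).exists_isMaxOn
    (NormedSpace.sphere_nonempty.2 zero_le_one) hgc.continuousOn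
  have hv1 : ‖v‖ = 1 := mem_sphere_zero_iff_norm.1 hv
  set M := gauge K v
  have hMpos : 0 < M := hgpos v hv
  have hinf : sInf (radFn K '' sphere (0 : EuclideanSpace ℝ (Fin n)) 1) = M⁻¹ := by
    refine IsLeast.csInf_eq ⟨⟨v, hv, hrad v hv⟩, ?_⟩
    rintro _ ⟨u, hu, rfl⟩
    rw [hrad u hu]
    exact inv_anti₀ (hgpos u hu) (hvmax hu)
  have hgM : ∀ x, gauge K x ≤ M * ‖x‖ := fun x => by
    rcases eq_or_ne x 0 with rfl | hx
    · simp
    · have h1 : gauge K (‖x‖⁻¹ • x) ≤ M := hvmax (by simp [norm_smul, hx])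
      rw [gauge_smul_of_nonneg (by positivity), smul_eq_mul, inv_mul_le_iff₀ (by positivity)] at h1
      linarith
  have hlower : ∀ u, M * |⟪u, v⟫| ≤ gauge K u := fun u => by
    rcases abs_choice ⟪u, v⟫ with h | h
    · rw [h]
      exact mul_inner_le_gauge hKc hK hgM hv1 rfl u
    · rw [h, ← inner_neg_left, ← gauge_neg hsymm u]
      exact mul_inner_le_gauge hKc hK hgM hv1 rfl (-u)
  have hlogg : Continuous fun u : sphere (0 : EuclideanSpace ℝ (Fin n)) 1 =>
      Real.log (gauge K u) :=
    (hgc.comp continuous_subtype_val).log fun u => (hgpos u u.2).ne'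
  have hlogQ : Continuous fun u : sphere (0 : EuclideanSpace ℝ (Fin n)) 1 => Real.log (ρQ u) :=
    hρQc'.log fun u => (hρQpos u u.2).ne'
  have hsplit : ∀ u : sphere (0 : EuclideanSpace ℝ (Fin n)) 1,
      Real.log (radFn K u / ρQ u) * ρQ u ^ n =
        ((Real.log M - Real.log (gauge K u)) * ρQ u ^ n - Real.log (ρQ u) * ρQ u ^ n) +
          Real.log M⁻¹ * ρQ u ^ n := fun u => by
    rw [hrad u u.2, Real.log_div (inv_pos.2 (hgpos u u.2)).ne' (hρQpos u u.2).ne', Real.log_inv,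
      Real.log_inv]
    ring
  have hexcess : ∫ u : sphere (0 : EuclideanSpace ℝ (Fin n)) 1,
      (Real.log M - Real.log (gauge K u)) * ρQ u ^ n ∂σ ≤ (ENNReal.ofReal B * D).toReal := by
    have hcont : Continuous fun u : sphere (0 : EuclideanSpace ℝ (Fin n)) 1 =>
        (Real.log M - Real.log (gauge K u)) * ρQ u ^ n :=
      (continuous_const.sub hlogg).mul (hρQc'.pow n)
    have hnonneg : ∀ u : sphere (0 : EuclideanSpace ℝ (Fin n)) 1,
        0 ≤ (Real.log M - Real.log (gauge K u)) * ρQ u ^ n := fun u =>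
      mul_nonneg (sub_nonneg.2 (Real.log_le_log (hgpos u u.2) (hvmax u.2)))
        (pow_nonneg (hρQpos u u.2).le n)
    rw [integral_eq_lintegral_of_nonneg_ae (.of_forall hnonneg) hcont.aestronglyMeasurable]
    refine ENNReal.toReal_mono (ENNReal.mul_ne_top ENNReal.ofReal_ne_top hDtop) ?_
    calc _ ≤ ∫⁻ u : sphere (0 : EuclideanSpace ℝ (Fin n)) 1, ENNReal.ofReal B *
            negLogAbs ⟪(u : EuclideanSpace ℝ (Fin n)), v⟫ ∂σ := by
          refine lintegral_mono fun u => ?_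
          rw [mul_comm, ENNReal.ofReal_mul (pow_nonneg (hρQpos u u.2).le n)]
          gcongr
          · exact (le_abs_self _).trans (hB u u.2)
          · unfold negLogAbs
            split_ifs with h0
            · exact le_top
            · refine ENNReal.ofReal_le_ofReal ?_
              have h := Real.log_le_log (by positivity) (hlower u)
              rw [Real.log_mul hMpos.ne' (abs_ne_zero.2 h0), Real.log_abs] at h
              linarith
      _ = ENNReal.ofReal B * ∫⁻ u : sphere (0 : EuclideanSpace ℝ (Fin n)) 1,
            negLogAbs ⟪(u : EuclideanSpace ℝ (Fin n)), v⟫ ∂σ :=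
          lintegral_const_mul' _ _ ENNReal.ofReal_ne_top
      _ ≤ ENNReal.ofReal B * D := by
          gcongr
          exact hD v hv1
  have hi₁ : Integrable (fun u : sphere (0 : EuclideanSpace ℝ (Fin n)) 1 =>
      (Real.log M - Real.log (gauge K u)) * ρQ u ^ n) σ :=
    hIntegrable _ ((continuous_const.sub hlogg).mul (hρQc'.pow n))
  have hi₂ : Integrable (fun u : sphere (0 : EuclideanSpace ℝ (Fin n)) 1 =>
      Real.log (ρQ u) * ρQ u ^ n) σ := hIntegrable _ (hlogQ.mul (hρQc'.pow n))
  have hi₁₂ : Integrable (fun u : sphere (0 : EuclideanSpace ℝ (Fin n)) 1 =>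
      (Real.log M - Real.log (gauge K u)) * ρQ u ^ n - Real.log (ρQ u) * ρQ u ^ n) σ :=
    hi₁.sub hi₂
  have hi₃ : Integrable (fun u : sphere (0 : EuclideanSpace ℝ (Fin n)) 1 =>
      Real.log M⁻¹ * ρQ u ^ n) σ := hIntegrable _ (continuous_const.mul (hρQc'.pow n))
  rw [hinf, integral_congr_ae (.of_forall hsplit), integral_add hi₁₂ hi₃,
    integral_sub hi₁ hi₂, integral_const_mul]
  have hn0 : (0 : ℝ) ≤ 1 / n := by positivity
  linarith [mul_le_mul_of_nonneg_left hexcess hn0]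
end

section
/- Let Q be a star body in ℝ^n with 0 < ρ_min ≤ ρ_Q ≤ ρ_max on S^{n-1}, let q ∈ (0,n) be a non-integer, and let E ⊂ ℝ^n be an origin-centered ellipsoid with semi-axis lengths 0 < b_1 ≤ … ≤ b_n. Then there exist positive constants c, C depending only on n, q, ρ_min, ρ_max such that c·b_1⋯b_{⌈q⌉}·b_{⌈q⌉}^{q−⌈q⌉} ≤ Ṽ_q(E,Q) ≤ C·b_1⋯b_{⌈q⌉}·b_{⌈q⌉}^{q−⌈q⌉}, where Ṽ_q(E,Q) = (1/n)∫_{S^{n-1}} ρ_E^q ρ_Q^{n-q} du. -/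
open Metric MeasureTheory Finset Matrix

open scoped Pointwise

/-- The gauge of the axis-parallel ellipsoid with semi-axes `b i`. -/
noncomputable def ellipsoidGauge {n : ℕ} (b : Fin n → ℝ) (x : EuclideanSpace ℝ (Fin n)) : ℝ :=
  ‖WithLp.toLp 2 (fun i => (b i)⁻¹ * x i)‖

section Gauge

variable {n : ℕ} {b : Fin n → ℝ}

lemma ellipsoidGauge_continuous : Continuous (ellipsoidGauge b) := by
  unfold ellipsoidGauge
  fun_prop

lemma ellipsoidGauge_nonneg (x : EuclideanSpace ℝ (Fin n)) : 0 ≤ ellipsoidGauge b x :=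
  norm_nonneg _

lemma ellipsoidGauge_smul (r : ℝ) (x : EuclideanSpace ℝ (Fin n)) :
    ellipsoidGauge b (r • x) = |r| * ellipsoidGauge b x := by
  unfold ellipsoidGauge
  rw [← Real.norm_eq_abs, ← norm_smul]
  congr 1
  ext i
  simp
  ring

lemma abs_apply_le_mul_ellipsoidGauge (hb : ∀ i, 0 < b i) (x : EuclideanSpace ℝ (Fin n))
    (i : Fin n) : |x i| ≤ b i * ellipsoidGauge b x := by
  have h := PiLp.norm_apply_le (WithLp.toLp 2 (fun i => (b i)⁻¹ * x i)) i
  simp only [Real.norm_eq_abs, abs_mul, abs_inv, abs_of_pos (hb i)] at h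
  rwa [inv_mul_le_iff₀ (hb i)] at h

lemma ellipsoidGauge_pos (hb : ∀ i, 0 < b i) {x : EuclideanSpace ℝ (Fin n)} (hx : x ≠ 0) :
    0 < ellipsoidGauge b x := by
  refine (ellipsoidGauge_nonneg x).lt_of_ne fun h => hx ?_
  ext i
  have := abs_apply_le_mul_ellipsoidGauge hb x i
  rw [← h, mul_zero] at this
  simpa using this

lemma EuclideanSpace.norm_le_of_abs_apply_le {x : EuclideanSpace ℝ (Fin n)} {a : ℝ}
    (h : ∀ i, |x i| ≤ a) : ‖x‖ ≤ n * a := by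
  calc ‖x‖ = ‖∑ i, EuclideanSpace.single i (x i)‖ := by
        congr 1
        ext j
        simp [Finset.sum_apply, Pi.single_apply]
    _ ≤ ∑ i, ‖EuclideanSpace.single i (x i)‖ := norm_sum_le _ _
    _ ≤ ∑ _i : Fin n, a := Finset.sum_le_sum fun i _ => by simpa using h i
    _ = n * a := by simp

lemma EuclideanSpace.volume_box (l u : Fin n → ℝ) :
    volume {y : EuclideanSpace ℝ (Fin n) | ∀ i, y i ∈ Set.Icc (l i) (u i)} =
      ∏ i, ENNReal.ofReal (u i - l i) := by
  rw [← Real.volume_Icc_pi, ← (EuclideanSpace.volume_preserving_symm_measurableEquiv_toLp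
    (Fin n)).measure_preimage measurableSet_Icc.nullMeasurableSet]
  congr 1
  ext y
  simp [Set.mem_Icc, Pi.le_def, forall_and]

lemma card_filter_lt_eq_val (k : Fin n) : (univ.filter (· < k)).card = (k : ℕ) := by
  rw [← Fin.card_Iio k]
  congr 1
  ext
  simp

lemma prod_ite_lt_mul_ite_eq (k : Fin n) (f : Fin n → ℝ) (a : ℝ) :
    ∏ i, ((if i < k then f i else 1) * (if i = k then a else 1)) =
      (∏ i ∈ univ.filter (· < k), f i) * a := by
  rw [Finset.prod_mul_distrib, Finset.prod_ite_eq' univ k, Finset.prod_filter]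
  simp

variable (L : EuclideanSpace ℝ (Fin n) ≃ₗᵢ[ℝ] EuclideanSpace ℝ (Fin n))

lemma mem_Ioo_smul_sphere_iff {p : EuclideanSpace ℝ (Fin n) → Prop}
    {x : EuclideanSpace ℝ (Fin n)} :
    x ∈ Set.Ioo (0 : ℝ) 1 • ((↑) '' {u : sphere (0 : EuclideanSpace ℝ (Fin n)) 1 | p u}) ↔
      x ≠ 0 ∧ ‖x‖ < 1 ∧ p (‖x‖⁻¹ • x) := by
  constructor
  · rintro ⟨r, ⟨hr0, hr1⟩, -, ⟨⟨u, hu⟩, hp, rfl⟩, rfl⟩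
    have hu1 : ‖u‖ = 1 := by simpa using hu
    have hn : ‖r • u‖ = r := by rw [norm_smul, hu1, mul_one, Real.norm_of_nonneg hr0.le]
    refine ⟨?_, by simpa only [hn] using hr1, ?_⟩
    · rw [← norm_ne_zero_iff, hn]; exact hr0.ne'
    · simp only [hn]
      rwa [smul_smul, inv_mul_cancel₀ hr0.ne', one_smul]
  · rintro ⟨h0, h1, hp⟩
    have hn : 0 < ‖x‖ := norm_pos_iff.2 h0
    refine ⟨‖x‖, ⟨hn, h1⟩, ‖x‖⁻¹ • x, ⟨⟨‖x‖⁻¹ • x, ?_⟩, hp, rfl⟩, ?_⟩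
    · simp [norm_smul, hn.ne']
    · simp [smul_smul, hn.ne']

lemma measurable_ellipsoidGauge_inv :
    Measurable fun u : sphere (0 : EuclideanSpace ℝ (Fin n)) 1 =>
      (ellipsoidGauge b (L u))⁻¹ :=
  (ellipsoidGauge_continuous.comp (L.continuous.comp continuous_subtype_val)).measurable.inv

lemma ellipsoidGauge_map_pos (hb : ∀ i, 0 < b i)
    (u : sphere (0 : EuclideanSpace ℝ (Fin n)) 1) : 0 < ellipsoidGauge b (L u) :=
  ellipsoidGauge_pos hb (by simpa using ne_zero_of_mem_unit_sphere u)

lemma toSphere_lt_inv_gauge_le (hb : ∀ i, 0 < b i) (k : Fin n) {t : ℝ} (ht : 0 < t) :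
    (volume : Measure (EuclideanSpace ℝ (Fin n))).toSphere
        {u | t < (ellipsoidGauge b (L u))⁻¹} ≤
      ENNReal.ofReal (n * (2 ^ n * ((∏ i ∈ univ.filter (· < k), b i / t) * min 1 (b k / t)))) := by
  rw [Measure.toSphere_apply' _
    (measurableSet_lt measurable_const (measurable_ellipsoidGauge_inv L)),
    finrank_euclideanSpace_fin, ENNReal.ofReal_mul (by positivity), ENNReal.ofReal_natCast]
  gcongr
  set β : Fin n → ℝ := fun i => (if i < k then b i / t else 1) *
    (if i = k then min 1 (b k / t) else 1) with hβ
  have hβ0 : ∀ i, 0 ≤ β i := fun i => by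
    have := hb i
    have := hb k
    simp only [hβ]
    positivity
  have hbox : volume {y : EuclideanSpace ℝ (Fin n) | ∀ i, y i ∈ Set.Icc (-β i) (β i)} =
      ENNReal.ofReal (2 ^ n * ((∏ i ∈ univ.filter (· < k), b i / t) * min 1 (b k / t))) := by
    rw [EuclideanSpace.volume_box, ← ENNReal.ofReal_prod_of_nonneg
      (fun i _ => by linarith [hβ0 i]), ← prod_ite_lt_mul_ite_eq]
    congr 1
    simp_rw [sub_neg_eq_add, ← two_mul]
    rw [Finset.prod_mul_distrib]
    simp [hβ]
  rw [← hbox, ← L.measurePreserving.measure_preimage_equiv (f := L.toMeasurableEquiv)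
    {y | ∀ i, y i ∈ Set.Icc (-β i) (β i)}]
  refine measure_mono fun x hx => ?_
  rw [mem_Ioo_smul_sphere_iff (p := fun u => t < (ellipsoidGauge b (L u))⁻¹)] at hx
  obtain ⟨hx0, hx1, hx⟩ := hx
  have hn : 0 < ‖x‖ := norm_pos_iff.2 hx0
  have hg : ellipsoidGauge b (L x) ≤ 1 / t := by
    have hgp : 0 < ellipsoidGauge b (L x) := ellipsoidGauge_pos hb (by simpa using hx0)
    rw [map_smul, ellipsoidGauge_smul, abs_of_pos (by positivity), mul_inv, inv_inv,
      ← div_eq_mul_inv, lt_div_iff₀ hgp] at hx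
    rw [le_div_iff₀ ht]
    linarith
  have h1 : ∀ i, |L x i| ≤ b i / t := fun i =>
    (abs_apply_le_mul_ellipsoidGauge hb _ i).trans
      ((mul_le_mul_of_nonneg_left hg (hb i).le).trans_eq (by ring))
  have h2 : ∀ i, |L x i| ≤ 1 := fun i => by
    have := PiLp.norm_apply_le (L x) i
    rw [Real.norm_eq_abs, L.norm_map] at this
    linarith
  intro i
  change L x i ∈ Set.Icc (-β i) (β i)
  rw [Set.mem_Icc, ← abs_le]
  simp only [hβ]
  rcases lt_trichotomy i k with h | rfl | h
  · simpa [h, h.ne] using h1 i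
  · simpa using ⟨h2 i, h1 i⟩
  · simpa [h.not_gt, h.ne'] using h2 i

lemma le_toSphere_le_inv_gauge (hb : ∀ i, 0 < b i) (hmono : Monotone b) (k : Fin n) :
    n * ((1 / (2 * n)) ^ n * ((∏ i ∈ univ.filter (· < k), b i / b k) * (1 / 2))) ≤
      (volume : Measure (EuclideanSpace ℝ (Fin n))).toSphere.real
        {u | b k / (4 * n) ≤ (ellipsoidGauge b (L u))⁻¹} := by
  have hbk := hb k
  have hn : (0 : ℝ) < n := by exact_mod_cast k.pos
  have hprod : 0 ≤ ∏ i ∈ univ.filter (· < k), b i / b k :=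
    Finset.prod_nonneg fun i _ => (div_pos (hb i) hbk).le
  rw [measureReal_def, ← ENNReal.ofReal_le_iff_le_toReal (measure_ne_top _ _),
    Measure.toSphere_apply' _
    (measurableSet_le measurable_const (measurable_ellipsoidGauge_inv L)),
    finrank_euclideanSpace_fin, ENNReal.ofReal_mul (by positivity), ENNReal.ofReal_natCast]
  gcongr
  set c : ℝ := 1 / (2 * n) with hc
  have hc0 : 0 < c := by positivity
  have hnc : n * c = 1 / 2 := by rw [hc]; field_simp
  set l : Fin n → ℝ := fun i => if i = k then c / 2 else 0 with hl
  set w : Fin n → ℝ := fun i => c * if i < k then b i / b k else 1 with hw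
  have hwl : ∀ i, w i - l i = c * ((if i < k then b i / b k else 1) *
      (if i = k then 1 / 2 else 1)) := fun i => by
    simp only [hw, hl]
    split_ifs with h1 h2 h2
    · exact absurd h2 h1.ne
    · ring
    · ring
    · ring
  have hbox : volume {y : EuclideanSpace ℝ (Fin n) | ∀ i, y i ∈ Set.Icc (l i) (w i)} =
      ENNReal.ofReal (c ^ n * ((∏ i ∈ univ.filter (· < k), b i / b k) * (1 / 2))) := by
    rw [EuclideanSpace.volume_box, ← ENNReal.ofReal_prod_of_nonneg, ← prod_ite_lt_mul_ite_eq]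
    · congr 1
      simp_rw [hwl]
      rw [Finset.prod_mul_distrib]
      simp
    · intro i _
      rw [hwl]
      have := hb i
      positivity
  rw [← hbox, ← L.measurePreserving.measure_preimage_equiv (f := L.toMeasurableEquiv)]
  refine measure_mono fun x hx => ?_
  replace hx : ∀ i, L x i ∈ Set.Icc (l i) (w i) := hx
  have hl0 : ∀ i, 0 ≤ l i := fun i => by simp only [hl]; positivity
  have habs : ∀ i, |L x i| ≤ w i := fun i => by
    rw [abs_of_nonneg ((hl0 i).trans (hx i).1)]
    exact (hx i).2
  have hwc : ∀ i, w i ≤ c := fun i => by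
    simp only [hw]
    split_ifs with h
    · exact mul_le_of_le_one_right hc0.le ((div_le_one hbk).2 (hmono h.le))
    · simp
  have hwb : ∀ i, (b i)⁻¹ * w i ≤ c / b k := fun i => by
    have hbi := hb i
    simp only [hw]
    split_ifs with h
    · apply le_of_eq; field_simp
    · rw [mul_one, inv_mul_eq_div]
      exact div_le_div_of_nonneg_left hc0.le hbk (hmono (not_lt.1 h))
  have hxn : ‖x‖ ≤ 1 / 2 := by
    rw [← L.norm_map, ← hnc]
    exact EuclideanSpace.norm_le_of_abs_apply_le fun i => (habs i).trans (hwc i)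
  have hxl : c / 2 ≤ ‖x‖ := by
    have h1 := (hx k).1
    have h2 := PiLp.norm_apply_le (L x) k
    rw [L.norm_map, Real.norm_eq_abs] at h2
    simp only [hl, if_true] at h1
    exact h1.trans ((le_abs_self _).trans h2)
  have hx0 : 0 < ‖x‖ := lt_of_lt_of_le (by positivity) hxl
  have hg : ellipsoidGauge b (L x) ≤ 1 / (2 * b k) := by
    have : ellipsoidGauge b (L x) ≤ n * (c / b k) :=
      EuclideanSpace.norm_le_of_abs_apply_le fun i => by
        have hbi := hb i
        simp only [abs_mul, abs_inv, abs_of_pos hbi]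
        exact (mul_le_mul_of_nonneg_left (habs i) (by positivity)).trans (hwb i)
    refine this.trans_eq ?_
    rw [← mul_div_assoc, hnc]
    field_simp
  rw [mem_Ioo_smul_sphere_iff (p := fun u => b k / (4 * n) ≤ (ellipsoidGauge b (L u))⁻¹)]
  refine ⟨norm_pos_iff.1 hx0, by linarith, ?_⟩
  have hgp : 0 < ellipsoidGauge b (L x) :=
    ellipsoidGauge_pos hb (by simpa using norm_pos_iff.1 hx0)
  rw [map_smul, ellipsoidGauge_smul, abs_of_pos (by positivity), mul_inv, inv_inv,
    ← div_eq_mul_inv, le_div_iff₀ hgp]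
  calc b k / (4 * n) * ellipsoidGauge b (L x) ≤ b k / (4 * n) * (1 / (2 * b k)) := by gcongr
    _ = c / 4 := by rw [hc]; field_simp
    _ ≤ ‖x‖ := by linarith

end Gauge

lemma setLIntegral_rpow_mul_min_one_le {q s a : ℝ} (hsq : s < q) (hqs : q < s + 1) (ha : 0 < a) :
    ∫⁻ t in Set.Ioi 0, ENNReal.ofReal (min 1 (a / t) * t ^ (q - s - 1)) ≤
      ENNReal.ofReal ((1 / (q - s) + 1 / (s + 1 - q)) * a ^ (q - s)) := by
  have hq1 : 0 < q - s := by linarith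
  have hq2 : 0 < s + 1 - q := by linarith
  have h1 : ∫⁻ t in Set.Ioc 0 a, ENNReal.ofReal (min 1 (a / t) * t ^ (q - s - 1)) ≤
      ENNReal.ofReal (a ^ (q - s) / (q - s)) := by
    calc _ ≤ ∫⁻ t in Set.Ioc 0 a, ENNReal.ofReal (t ^ (q - s - 1)) := by
          refine setLIntegral_mono' measurableSet_Ioc fun t ht => ENNReal.ofReal_le_ofReal ?_
          exact mul_le_of_le_one_left (Real.rpow_nonneg ht.1.le _) (min_le_left _ _)
      _ = ENNReal.ofReal (a ^ (q - s) / (q - s)) := by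
          have hint : IntegrableOn (fun t : ℝ => t ^ (q - s - 1)) (Set.Ioc 0 a) :=
            (intervalIntegrable_iff_integrableOn_Ioc_of_le ha.le).1
              (intervalIntegral.intervalIntegrable_rpow' (by linarith))
          rw [← ofReal_integral_eq_lintegral_ofReal hint
            ((ae_restrict_iff' measurableSet_Ioc).2
              (Filter.Eventually.of_forall fun t ht => Real.rpow_nonneg ht.1.le _)),
            ← intervalIntegral.integral_of_le ha.le, integral_rpow (Or.inl (by linarith)),
            sub_add_cancel, Real.zero_rpow hq1.ne', sub_zero]
  have h2 : ∫⁻ t in Set.Ioi a, ENNReal.ofReal (min 1 (a / t) * t ^ (q - s - 1)) ≤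
      ENNReal.ofReal (a ^ (q - s) / (s + 1 - q)) := by
    calc _ ≤ ∫⁻ t in Set.Ioi a, ENNReal.ofReal (a * t ^ (q - s - 2)) := by
          refine setLIntegral_mono' measurableSet_Ioi fun t ht => ENNReal.ofReal_le_ofReal ?_
          have ht0 : 0 < t := ha.trans ht
          calc _ ≤ a / t * t ^ (q - s - 1) := by gcongr; exact min_le_right _ _
            _ = a * t ^ (q - s - 2) := by
              rw [show q - s - 2 = (q - s - 1) - 1 by ring, Real.rpow_sub_one ht0.ne' (q - s - 1)]
              ring
      _ = ENNReal.ofReal (a ^ (q - s) / (s + 1 - q)) := by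
          have hint := (integrableOn_Ioi_rpow_of_lt (a := q - s - 2) (by linarith) ha).const_mul a
          rw [← ofReal_integral_eq_lintegral_ofReal hint
            ((ae_restrict_iff' measurableSet_Ioi).2
              (Filter.Eventually.of_forall fun t ht =>
                mul_nonneg ha.le (Real.rpow_nonneg (ha.trans ht).le _))),
            integral_const_mul, integral_Ioi_rpow_of_lt (by linarith) ha,
            show q - s - 2 + 1 = q - s - 1 by ring, Real.rpow_sub_one ha.ne']
          congr 1
          have : q - s - 1 ≠ 0 := by linarith
          field_simp
          ring
  rw [← Set.Ioc_union_Ioi_eq_Ioi ha.le]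
  refine (lintegral_union_le _ _ _).trans ((add_le_add h1 h2).trans_eq ?_)
  rw [← ENNReal.ofReal_add (by positivity) (by positivity)]
  congr 1
  ring

section Sphere

variable {n : ℕ} {b : Fin n → ℝ}
  (L : EuclideanSpace ℝ (Fin n) ≃ₗᵢ[ℝ] EuclideanSpace ℝ (Fin n))

lemma lintegral_gauge_rpow_le (hb : ∀ i, 0 < b i) (k : Fin n) {q : ℝ}
    (hkq : (k : ℕ) < q) (hqk : q < (k : ℕ) + 1) :
    ∫⁻ u : sphere (0 : EuclideanSpace ℝ (Fin n)) 1,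
        ENNReal.ofReal ((ellipsoidGauge b (L u))⁻¹ ^ q)
        ∂(volume : Measure (EuclideanSpace ℝ (Fin n))).toSphere ≤
      ENNReal.ofReal (q * (n * 2 ^ n * (1 / (q - (k : ℕ)) + 1 / ((k : ℕ) + 1 - q))) *
        ((∏ i ∈ univ.filter (· < k), b i) * b k ^ (q - (k : ℕ)))) := by
  have hq : 0 < q := (Nat.cast_nonneg _).trans_lt hkq
  have hprod : 0 ≤ ∏ i ∈ univ.filter (· < k), b i := Finset.prod_nonneg fun i _ => (hb i).le
  rw [lintegral_rpow_eq_lintegral_meas_lt_mul _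
    (Filter.Eventually.of_forall fun u => inv_nonneg.2 (ellipsoidGauge_nonneg _))
    (measurable_ellipsoidGauge_inv L).aemeasurable hq]
  set K : ℝ := n * 2 ^ n * ∏ i ∈ univ.filter (· < k), b i with hK
  have hK0 : 0 ≤ K := by positivity
  calc _ ≤ ENNReal.ofReal q * ∫⁻ t in Set.Ioi 0, ENNReal.ofReal K *
        ENNReal.ofReal (min 1 (b k / t) * t ^ (q - (k : ℕ) - 1)) := by
        gcongr _ * ?_
        refine setLIntegral_mono' measurableSet_Ioi fun t (ht : 0 < t) => ?_
        have hbk := hb k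
        refine (mul_le_mul_left (toSphere_lt_inv_gauge_le L hb k ht) _).trans_eq ?_
        rw [← ENNReal.ofReal_mul' (by positivity), ← ENNReal.ofReal_mul hK0]
        congr 1
        rw [Finset.prod_div_distrib, Finset.prod_const, card_filter_lt_eq_val,
          show q - (k : ℕ) - 1 = (q - 1) - (k : ℕ) by ring, Real.rpow_sub_natCast ht.ne', hK]
        ring
    _ ≤ ENNReal.ofReal q * (ENNReal.ofReal K * ENNReal.ofReal
        ((1 / (q - (k : ℕ)) + 1 / ((k : ℕ) + 1 - q)) * b k ^ (q - (k : ℕ)))) := by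
        rw [lintegral_const_mul' _ _ ENNReal.ofReal_ne_top]
        gcongr
        exact setLIntegral_rpow_mul_min_one_le hkq hqk (hb k)
    _ = _ := by
        rw [← ENNReal.ofReal_mul hK0, ← ENNReal.ofReal_mul hq.le, hK]
        congr 1
        ring

lemma continuous_gauge_rpow (hb : ∀ i, 0 < b i) (q : ℝ) :
    Continuous fun u : sphere (0 : EuclideanSpace ℝ (Fin n)) 1 =>
      (ellipsoidGauge b (L u))⁻¹ ^ q := by
  have hc : Continuous fun u : sphere (0 : EuclideanSpace ℝ (Fin n)) 1 =>
      ellipsoidGauge b (L u) :=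
    ellipsoidGauge_continuous.comp (L.continuous.comp continuous_subtype_val)
  exact (hc.inv₀ fun u => (ellipsoidGauge_map_pos L hb u).ne').rpow_const
    fun u => Or.inl (inv_pos.2 (ellipsoidGauge_map_pos L hb u)).ne'

lemma Continuous.integrable_toSphere {f : sphere (0 : EuclideanSpace ℝ (Fin n)) 1 → ℝ}
    (hf : Continuous f) :
    Integrable f (volume : Measure (EuclideanSpace ℝ (Fin n))).toSphere :=
  hf.integrable_of_hasCompactSupport (HasCompactSupport.of_compactSpace f)

lemma integral_gauge_rpow_le (hb : ∀ i, 0 < b i) (k : Fin n) {q : ℝ}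
    (hkq : (k : ℕ) < q) (hqk : q < (k : ℕ) + 1) :
    ∫ u : sphere (0 : EuclideanSpace ℝ (Fin n)) 1, (ellipsoidGauge b (L u))⁻¹ ^ q
        ∂(volume : Measure (EuclideanSpace ℝ (Fin n))).toSphere ≤
      q * (n * 2 ^ n * (1 / (q - (k : ℕ)) + 1 / ((k : ℕ) + 1 - q))) *
        ((∏ i ∈ univ.filter (· < k), b i) * b k ^ (q - (k : ℕ))) := by
  have hq : 0 < q := (Nat.cast_nonneg _).trans_lt hkq
  have h1 : 0 < q - (k : ℕ) := by linarith
  have h2 : 0 < (k : ℕ) + 1 - q := by linarith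
  have hbk := hb k
  have hprod : 0 ≤ ∏ i ∈ univ.filter (· < k), b i := Finset.prod_nonneg fun i _ => (hb i).le
  rw [← ENNReal.ofReal_le_ofReal_iff (by positivity),
    ofReal_integral_eq_lintegral_ofReal (continuous_gauge_rpow L hb q).integrable_toSphere
      (Filter.Eventually.of_forall fun u =>
        Real.rpow_nonneg (inv_nonneg.2 (ellipsoidGauge_nonneg _)) _)]
  exact lintegral_gauge_rpow_le L hb k hkq hqk

lemma le_integral_gauge_rpow (hb : ∀ i, 0 < b i) (hmono : Monotone b) (k : Fin n) {q : ℝ}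
    (hq : 0 < q) :
    (1 / (4 * n)) ^ q * (n * ((1 / (2 * n)) ^ n * (1 / 2))) *
        ((∏ i ∈ univ.filter (· < k), b i) * b k ^ (q - (k : ℕ))) ≤
      ∫ u : sphere (0 : EuclideanSpace ℝ (Fin n)) 1, (ellipsoidGauge b (L u))⁻¹ ^ q
        ∂(volume : Measure (EuclideanSpace ℝ (Fin n))).toSphere := by
  have hbk := hb k
  have hn : (0 : ℝ) < n := by exact_mod_cast k.pos
  have hmeas := le_toSphere_le_inv_gauge L hb hmono k
  calc _ = (b k / (4 * n)) ^ q *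
        (n * ((1 / (2 * n)) ^ n * ((∏ i ∈ univ.filter (· < k), b i / b k) * (1 / 2)))) := by
        rw [Finset.prod_div_distrib, Finset.prod_const, card_filter_lt_eq_val, Real.rpow_sub_natCast hbk.ne',
          div_eq_mul_one_div (b k), Real.mul_rpow hbk.le (by positivity)]
        ring
    _ ≤ (b k / (4 * n)) ^ q * (volume : Measure (EuclideanSpace ℝ (Fin n))).toSphere.real
        {u | (b k / (4 * n)) ^ q ≤ (ellipsoidGauge b (L u))⁻¹ ^ q} := by
        refine mul_le_mul_of_nonneg_left (hmeas.trans_eq ?_) (by positivity)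
        congr 1
        ext u
        exact (Real.rpow_le_rpow_iff (by positivity)
          (inv_nonneg.2 (ellipsoidGauge_nonneg _)) hq).symm
    _ ≤ _ := mul_meas_ge_le_integral_of_nonneg
        (Filter.Eventually.of_forall fun u =>
          Real.rpow_nonneg (inv_nonneg.2 (ellipsoidGauge_nonneg _)) _)
        (continuous_gauge_rpow L hb q).integrable_toSphere _

end Sphere

lemma radFn_setOf_gauge_le_one {n : ℕ} {g : EuclideanSpace ℝ (Fin n) → ℝ}
    (hg : ∀ (r : ℝ) x, g (r • x) = |r| * g x) {u : EuclideanSpace ℝ (Fin n)} (hu : 0 < g u) :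
    radFn {y | g y ≤ 1} u = (g u)⁻¹ := by
  have : {r : ℝ | 0 < r ∧ r • u ∈ {y | g y ≤ 1}} = Set.Ioc 0 (g u)⁻¹ := by
    ext r
    simp only [Set.mem_ofPred_eq, Set.mem_Ioc, hg]
    refine and_congr_right fun hr => ?_
    rw [abs_of_pos hr, ← one_div, le_div_iff₀ hu]
  rw [radFn, this, csSup_Ioc (inv_pos.2 hu)]

/-- The linear isometry of Euclidean space given by an orthogonal matrix. -/
noncomputable def orthogonalIsometry {n : ℕ} (P : Matrix (Fin n) (Fin n) ℝ) (hP : Pᵀ * P = 1) :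
    EuclideanSpace ℝ (Fin n) ≃ₗᵢ[ℝ] EuclideanSpace ℝ (Fin n) :=
  LinearIsometry.toLinearIsometryEquiv
    { toLinearMap := Matrix.toEuclideanLin P
      norm_map' := fun x => by
        rw [← sq_eq_sq₀ (norm_nonneg _) (norm_nonneg _), EuclideanSpace.real_norm_sq_eq,
          EuclideanSpace.real_norm_sq_eq]
        have h : (P *ᵥ x.ofLp) ⬝ᵥ (P *ᵥ x.ofLp) = x.ofLp ⬝ᵥ x.ofLp := by
          rw [Matrix.dotProduct_mulVec, Matrix.vecMul_mulVec, hP, Matrix.vecMul_one]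
        simpa [dotProduct, sq] using h } rfl

lemma orthogonalIsometry_apply {n : ℕ} (P : Matrix (Fin n) (Fin n) ℝ) (hP : Pᵀ * P = 1)
    (x : EuclideanSpace ℝ (Fin n)) (i : Fin n) :
    orthogonalIsometry P hP x i = (P *ᵥ x.ofLp) i := rfl

/-- Sharp estimate of `Ṽ_q(E,Q)` for an origin-centered ellipsoid `E` with semi-axes
`b₁ ≤ ⋯ ≤ bₙ` and non-integer `q ∈ (0,n)`:
`Ṽ_q(E,Q) ≈ b₁⋯b_{⌈q⌉}·b_{⌈q⌉}^{q-⌈q⌉}`, with constants depending only on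
`n`, `q`, `min ρ_Q`, `max ρ_Q`. -/
theorem dual_quermassintegral_ellipsoid_noninteger (n : ℕ) (q : ℝ) (hq0 : 0 < q)
    (hqn : q < n) (hni : ∀ m : ℤ, q ≠ m)
    (ρmin ρmax : ℝ) (hρmin : 0 < ρmin) (hρ : ρmin ≤ ρmax) :
    ∃ c C : ℝ, 0 < c ∧ 0 < C ∧
      ∀ ρQ : EuclideanSpace ℝ (Fin n) → ℝ, ContinuousOn ρQ (sphere 0 1) →
        (∀ u ∈ sphere (0 : EuclideanSpace ℝ (Fin n)) 1, ρmin ≤ ρQ u ∧ ρQ u ≤ ρmax) →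
      ∀ b : Fin n → ℝ, (∀ i, 0 < b i) → (∀ i j : Fin n, i ≤ j → b i ≤ b j) →
      ∀ P : Matrix (Fin n) (Fin n) ℝ, Pᵀ * P = 1 →
      ∀ E : Set (EuclideanSpace ℝ (Fin n)),
        E = {y : EuclideanSpace ℝ (Fin n) |
          ‖(EuclideanSpace.equiv (Fin n) ℝ).symm
            ((Matrix.diagonal (fun i => (b i)⁻¹)).mulVec
              (P.mulVec (y : EuclideanSpace ℝ (Fin n))))‖ ≤ 1} →
        c * ((∏ i ∈ Finset.univ.filter (fun i : Fin n => (i : ℕ) < ⌈q⌉₊), b i) *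
              b ⟨⌈q⌉₊ - 1, by
                have h1 : ⌈q⌉₊ ≤ n := Nat.ceil_le.mpr hqn.le
                have h2 : 0 < ⌈q⌉₊ := Nat.ceil_pos.mpr hq0
                omega⟩ ^ (q - ⌈q⌉₊)) ≤
          ((1 : ℝ) / n) * (∫ u : sphere (0 : EuclideanSpace ℝ (Fin n)) 1,
            radFn E (u : EuclideanSpace ℝ (Fin n)) ^ q *
              ρQ (u : EuclideanSpace ℝ (Fin n)) ^ ((n : ℝ) - q)
            ∂(volume : Measure (EuclideanSpace ℝ (Fin n))).toSphere) ∧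
        ((1 : ℝ) / n) * (∫ u : sphere (0 : EuclideanSpace ℝ (Fin n)) 1,
            radFn E (u : EuclideanSpace ℝ (Fin n)) ^ q *
              ρQ (u : EuclideanSpace ℝ (Fin n)) ^ ((n : ℝ) - q)
            ∂(volume : Measure (EuclideanSpace ℝ (Fin n))).toSphere) ≤
          C * ((∏ i ∈ Finset.univ.filter (fun i : Fin n => (i : ℕ) < ⌈q⌉₊), b i) *
              b ⟨⌈q⌉₊ - 1, by
                have h1 : ⌈q⌉₊ ≤ n := Nat.ceil_le.mpr hqn.le
                have h2 : 0 < ⌈q⌉₊ := Nat.ceil_pos.mpr hq0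
                omega⟩ ^ (q - ⌈q⌉₊)) := by
  have hn : (0 : ℝ) < n := hq0.trans hqn
  have hceil : 0 < ⌈q⌉₊ := Nat.ceil_pos.mpr hq0
  obtain ⟨k, hk⟩ : ∃ k : Fin n, ⌈q⌉₊ = (k : ℕ) + 1 :=
    ⟨⟨⌈q⌉₊ - 1, by have := Nat.ceil_le.mpr hqn.le; omega⟩, by simp only; omega⟩
  have hkq : ((k : ℕ) : ℝ) < q := Nat.lt_ceil.1 (by omega)
  have hqk : q < ((k : ℕ) : ℝ) + 1 := by
    have h : q ≤ ((k : ℕ) : ℝ) + 1 := by exact_mod_cast hk ▸ Nat.le_ceil q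
    refine h.lt_of_ne ?_
    exact_mod_cast hni ((k : ℕ) + 1)
  have h1 : 0 < q - (k : ℕ) := by linarith
  have h2 : 0 < (k : ℕ) + 1 - q := by linarith
  have hρmax : 0 < ρmax := hρmin.trans_le hρ
  refine ⟨1 / n * (ρmin ^ ((n : ℝ) - q) *
      ((1 / (4 * n)) ^ q * (n * ((1 / (2 * n)) ^ n * (1 / 2))))),
    1 / n * (ρmax ^ ((n : ℝ) - q) *
      (q * (n * 2 ^ n * (1 / (q - (k : ℕ)) + 1 / ((k : ℕ) + 1 - q))))),
    by positivity, by positivity, ?_⟩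
  rintro ρQ hcont hbound b hb hmono P hP _ rfl
  set L := orthogonalIsometry P hP
  have hbk := hb k
  have hidx : ∀ h, (⟨⌈q⌉₊ - 1, h⟩ : Fin n) = k := fun _ => Fin.ext (by simp [hk])
  have hsize : (∏ i ∈ univ.filter (fun i : Fin n => (i : ℕ) < ⌈q⌉₊), b i) *
      b k ^ (q - ⌈q⌉₊) = (∏ i ∈ univ.filter (· < k), b i) * b k ^ (q - (k : ℕ)) := by
    have hset : univ.filter (fun i : Fin n => (i : ℕ) < ⌈q⌉₊) =
        insert k (univ.filter (· < k)) := by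
      ext i
      simp only [Finset.mem_filter, Finset.mem_univ, true_and, Finset.mem_insert, Fin.ext_iff,
        Fin.lt_def]
      omega
    rw [hset, Finset.prod_insert (by simp), hk, Nat.cast_succ, ← sub_sub,
      Real.rpow_sub_one hbk.ne']
    field_simp
  rw [hidx, hsize]
  have hrad : ∀ u : sphere (0 : EuclideanSpace ℝ (Fin n)) 1,
      radFn {y : EuclideanSpace ℝ (Fin n) |
          ‖(EuclideanSpace.equiv (Fin n) ℝ).symm
            ((Matrix.diagonal (fun i => (b i)⁻¹)).mulVec
              (P.mulVec (y : EuclideanSpace ℝ (Fin n))))‖ ≤ 1} u =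
        (ellipsoidGauge b (L u))⁻¹ := fun u => by
    rw [← radFn_setOf_gauge_le_one (g := fun x => ellipsoidGauge b (L x))
      (fun r x => by rw [map_smul, ellipsoidGauge_smul]) (ellipsoidGauge_map_pos L hb u)]
    congr 1
    ext y
    simp only [Set.mem_ofPred_eq, ellipsoidGauge]
    congr! 2
    ext i
    simp [-Matrix.mulVec_mulVec, Matrix.mulVec_diagonal, L, orthogonalIsometry_apply]
  simp_rw [hrad]
  have hnq : 0 ≤ (n : ℝ) - q := by linarith
  have hρQ : Continuous fun u : sphere (0 : EuclideanSpace ℝ (Fin n)) 1 =>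
      ρQ u ^ ((n : ℝ) - q) :=
    (continuousOn_iff_continuous_domRestrict.1 hcont).rpow_const fun _ => Or.inr hnq
  have hgauge := continuous_gauge_rpow L hb q
  have hg0 : ∀ u : sphere (0 : EuclideanSpace ℝ (Fin n)) 1,
      0 ≤ (ellipsoidGauge b (L u))⁻¹ ^ q := fun u =>
    Real.rpow_nonneg (inv_nonneg.2 (ellipsoidGauge_nonneg _)) _
  have hint := (hgauge.mul hρQ).integrable_toSphere
  constructor
  · rw [mul_assoc, mul_assoc]
    refine mul_le_mul_of_nonneg_left ?_ (by positivity)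
    refine (mul_le_mul_of_nonneg_left (le_integral_gauge_rpow L hb hmono k hq0)
      (by positivity)).trans ?_
    rw [← integral_const_mul]
    refine integral_mono (hgauge.integrable_toSphere.const_mul _) hint fun u => ?_
    simp only
    rw [mul_comm]
    exact mul_le_mul_of_nonneg_left
      (Real.rpow_le_rpow hρmin.le (hbound u u.2).1 hnq) (hg0 u)
  · rw [mul_assoc (1 / (n : ℝ)), mul_assoc (ρmax ^ _)]
    refine mul_le_mul_of_nonneg_left ?_ (by positivity)
    refine le_trans ?_ (mul_le_mul_of_nonneg_left (integral_gauge_rpow_le L hb k hkq hqk)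
      (by positivity))
    rw [← integral_const_mul]
    refine integral_mono hint (hgauge.integrable_toSphere.const_mul _) fun u => ?_
    simp only
    rw [mul_comm (ρmax ^ _)]
    exact mul_le_mul_of_nonneg_left
      (Real.rpow_le_rpow (hρmin.le.trans (hbound u u.2).1) (hbound u u.2).2 hnq) (hg0 u)
end
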